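/- arXiv:2107.05511 — 2 statements merged into one kernel-verified Lean document; each statement's English description precedes it below -/
import Mathlib

section
/- Let Γ₁ and Γ₂ be p-Jordan groups (for a fixed prime p). Then the direct product Γ₁ × Γ₂ is p-Jordan. Consequently, any finite direct product of p-Jordan groups is p-Jordan. -/
open AlgebraicGeometry CategoryTheory TopologicalSpace MvPolynomial Matrix
/-- A group `Γ` is `p`-Jordan with constants `J` and `e` if every finite subgroup
`G ≤ Γ` contains a normal abelian subgroup `A` with `[G : A] ≤ J * |G_p| ^ e`,
where `G_p` is a Sylow `p`-subgroup of `G`. -/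
def IsPJordanWith (p J e : ℕ) (Γ : Type*) [Group Γ] : Prop :=
  ∀ G : Subgroup Γ, Finite G →
    ∃ A : Subgroup ↥G, A.Normal ∧ (∀ a b : ↥A, a * b = b * a) ∧
      ∀ P : Sylow p ↥G, A.index ≤ J * Nat.card ↥(P : Subgroup ↥G) ^ e

/-- A group `Γ` is `p`-Jordan if there are constants `J` and `e`, depending only on `Γ`,
such that every finite subgroup `G ≤ Γ` contains a normal abelian subgroup `A` with
`[G : A] ≤ J * |G_p| ^ e`, where `G_p` is a Sylow `p`-subgroup of `G`. -/
def IsPJordan (p : ℕ) (Γ : Type*) [Group Γ] : Prop :=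
  ∃ J e : ℕ, IsPJordanWith p J e Γ

/-- Powers of a number `p` are eventually periodic modulo `n ≠ 0`, so some arbitrarily high
power of `p` is idempotent modulo `n`. -/
theorem Nat.exists_pow_add_self_modEq (p n k : ℕ) [NeZero n] :
    ∃ t, k ≤ t ∧ p ^ (t + t) ≡ p ^ t [MOD n] := by
  obtain ⟨i, j, hij, h⟩ : ∃ i j : ℕ, i < j ∧ (p : ZMod n) ^ i = (p : ZMod n) ^ j := by
    obtain ⟨i, j, hne, h⟩ :=
      Finite.exists_ne_map_eq_of_infinite (fun i : ℕ => (p : ZMod n) ^ i)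
    rcases hne.lt_or_gt with hlt | hlt
    exacts [⟨i, j, hlt, h⟩, ⟨j, i, hlt, h.symm⟩]
  obtain ⟨d, rfl⟩ := Nat.exists_eq_add_of_lt hij
  have periodic (l s : ℕ) : (p : ZMod n) ^ (i + s + (d + 1) * l) = (p : ZMod n) ^ (i + s) := by
    induction l with
    | zero => simp
    | succ l ih =>
      calc (p : ZMod n) ^ (i + s + (d + 1) * (l + 1))
          = (p : ZMod n) ^ (i + d + 1) * (p : ZMod n) ^ (s + (d + 1) * l) := by
            rw [← pow_add]; congr 1; ring
        _ = (p : ZMod n) ^ (i + s) := by rw [← h, ← pow_add, ← ih]; congr 1; ring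
  have hle : i + k ≤ (d + 1) * (i + k) := Nat.le_mul_of_pos_left _ d.succ_pos
  refine ⟨(d + 1) * (i + k), by omega, ?_⟩
  rw [← ZMod.natCast_eq_natCast_iff]
  push_cast
  obtain ⟨s, hs⟩ := Nat.exists_eq_add_of_le (show i ≤ (d + 1) * (i + k) by omega)
  have := periodic (i + k) s
  rwa [← hs] at this

/-- A homomorphism from a finite group to a `p`-group takes every value on some power of the
given argument that has `p`-power order. -/
theorem IsPGroup.exists_zpow_map_eq {p : ℕ} {H R : Type*} [Group H] [Finite H] [Group R]
    (hR : IsPGroup p R) (φ : H →* R) (h : H) :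
    ∃ m : ℤ, φ (h ^ m) = φ h ∧ ∃ t : ℕ, (h ^ m) ^ p ^ t = 1 := by
  obtain ⟨k, hk⟩ := hR (φ h)
  have : NeZero (orderOf h) := ⟨(orderOf_pos h).ne'⟩
  obtain ⟨t, hkt, ht⟩ := Nat.exists_pow_add_self_modEq p (orderOf h) k
  refine ⟨1 - (p ^ t : ℕ), ?_, t, ?_⟩
  · have : φ h ^ p ^ t = 1 := by
      rw [← Nat.add_sub_cancel' hkt, pow_add, pow_mul, hk, one_pow]
    rw [_root_.zpow_sub, zpow_one, zpow_natCast, map_mul, map_inv, map_pow, this, inv_one, mul_one]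
  · rw [_root_.zpow_sub, zpow_one, zpow_natCast, ((Commute.refl h).pow_right _).inv_right.mul_pow,
      inv_pow, ← pow_mul, ← pow_add, pow_eq_pow_iff_modEq.2 ht, mul_inv_cancel]

/-- The image of a maximal `p`-subgroup under a surjective homomorphism whose kernel is a
`p`-group is a maximal `p`-subgroup. -/
theorem Sylow.exists_coe_eq_map {p : ℕ} {G K : Type*} [Group G] [Group K] (P : Sylow p G)
    (f : G →* K) (hf : Function.Surjective f) (hker : IsPGroup p f.ker) :
    ∃ Q : Sylow p K, (Q : Subgroup K) = (P : Subgroup G).map f := by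
  refine ⟨⟨(P : Subgroup G).map f, P.isPGroup'.map f, fun {X} hX hle => ?_⟩, rfl⟩
  rw [← P.is_maximal' (hX.comap_of_ker_isPGroup f hker) (Subgroup.map_le_iff_le_comap.1 hle),
    Subgroup.map_comap_eq_self_of_surjective hf]

theorem Subgroup.card_map_le_card {G K : Type*} [Group G] [Group K] (H : Subgroup G) [Finite H]
    (f : G →* K) : Nat.card (H.map f) ≤ Nat.card H :=
  Nat.le_of_dvd Nat.card_pos (H.card_map_dvd f)

/-- Elements of `p`-power order in an abelian normal subgroup lie in every maximal
`p`-subgroup. -/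
theorem Sylow.mem_of_mem_normal_of_comm {p : ℕ} {K : Type*} [Group K] (P : Sylow p K)
    {A : Subgroup K} (hA : A.Normal) (hcomm : ∀ a b : A, a * b = b * a) {a : K} (ha : a ∈ A)
    {t : ℕ} (hat : a ^ p ^ t = 1) : a ∈ P := by
  let T : Subgroup K :=
    { carrier := {x | x ∈ A ∧ ∃ k : ℕ, x ^ p ^ k = 1}
      one_mem' := ⟨A.one_mem, 0, one_pow _⟩
      inv_mem' := fun {x} hx => ⟨A.inv_mem hx.1, hx.2.imp fun k hk => by rw [inv_pow, hk, inv_one]⟩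
      mul_mem' := by
        rintro x y ⟨hx, k, hk⟩ ⟨hy, l, hl⟩
        have hxy : Commute x y := congrArg Subtype.val (hcomm ⟨x, hx⟩ ⟨y, hy⟩)
        refine ⟨A.mul_mem hx hy, k + l, ?_⟩
        rw [hxy.mul_pow, pow_add, pow_mul, hk, one_pow, one_mul, mul_comm, pow_mul, hl, one_pow] }
  have hTn : T.Normal := ⟨fun x hx g => ⟨hA.conj_mem x hx.1 g, hx.2.imp fun k hk => by
    rw [conj_pow, hk, mul_one, mul_inv_cancel]⟩⟩
  have hTp : IsPGroup p T := fun x => x.2.2.imp fun k hk => Subtype.ext hk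
  exact hTp.le_sylow_of_normal P ⟨ha, t, hat⟩

/-- The defining property of a `p`-Jordan group, transported to a finite group acting through a
homomorphism `f`. -/
theorem IsPJordanWith.exists_normal {p J e : ℕ} {Γ H : Type*} [Group Γ] [Group H] [Finite H]
    (h : IsPJordanWith p J e Γ) (f : H →* Γ) :
    ∃ A : Subgroup H, A.Normal ∧ (∀ a ∈ A, ∀ b ∈ A, f a * f b = f b * f a) ∧
      ∀ P : Sylow p f.range, A.index ≤ J * Nat.card (P : Subgroup f.range) ^ e := by
  obtain ⟨A, hn, hc, hi⟩ := h f.range (Set.finite_range f).to_subtype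
  refine ⟨A.comap f.rangeRestrict, hn.comap _, fun a ha b hb => ?_, fun P => ?_⟩
  · exact congrArg (fun x : A => ((x : f.range) : Γ)) (hc ⟨_, ha⟩ ⟨_, hb⟩)
  · rw [Subgroup.index_comap_of_surjective _ f.rangeRestrict_surjective]
    exact hi P

/-- Pulling back along an injective homomorphism preserves being `p`-Jordan. -/
theorem IsPJordan.of_injective {p : ℕ} {Γ Γ' : Type*} [Group Γ] [Group Γ']
    (h : IsPJordan p Γ') (f : Γ →* Γ') (hf : Function.Injective f) : IsPJordan p Γ := by
  obtain ⟨J, e, h⟩ := h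
  refine ⟨J, e, fun G _ => ?_⟩
  have hinj : Function.Injective (f.comp G.subtype) := hf.comp G.subtype_injective
  obtain ⟨A, hn, hc, hi⟩ := h.exists_normal (f.comp G.subtype)
  refine ⟨A, hn, fun a b => Subtype.ext (hinj ?_), fun P => ?_⟩
  · simpa only [map_mul, Subgroup.coe_mul] using hc a a.2 b b.2
  · obtain ⟨Q, hQ⟩ := P.exists_coe_eq_map (f.comp G.subtype).rangeRestrict
      (MonoidHom.rangeRestrict_surjective _)
      (IsPGroup.ker_isPGroup_of_injective ((MonoidHom.rangeRestrict_injective_iff).2 hinj))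
    grw [hi Q, hQ, Subgroup.card_map_le_card]

/-- If a finite group `H` embeds in the product of a `p`-group `R` and a `p`-Jordan group, and
projects onto `R`, then `R` is polynomially bounded by the maximal `p`-subgroups of `H`. -/
theorem IsPJordanWith.card_le_of_isPGroup {p J e : ℕ} {Γ H R : Type*} [Group Γ] [Group H]
    [Finite H] [Group R] (h : IsPJordanWith p J e Γ) (hR : IsPGroup p R) (φ : H →* R)
    (hφ : Function.Surjective φ) (g : H →* Γ) (hker : Function.Injective (φ.prod g))
    (P : Sylow p H) : Nat.card R ≤ J * Nat.card (P : Subgroup H) ^ (e + 1) := by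
  have hgker : IsPGroup p g.rangeRestrict.ker := by
    refine hR.of_injective (φ.comp g.rangeRestrict.ker.subtype) fun x y hxy => ?_
    have hx : g x = 1 := congrArg Subtype.val x.2
    have hy : g y = 1 := congrArg Subtype.val y.2
    exact Subtype.ext (hker (Prod.ext hxy (hx.trans hy.symm)))
  obtain ⟨Q, hQ⟩ := P.exists_coe_eq_map g.rangeRestrict g.rangeRestrict_surjective hgker
  obtain ⟨A, hn, hc, hi⟩ := h g.range (Set.finite_range g).to_subtype
  set B := A.comap g.rangeRestrict with hB
  have hBi : B.index ≤ J * Nat.card (P : Subgroup H) ^ e := by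
    rw [hB, Subgroup.index_comap_of_surjective _ g.rangeRestrict_surjective]
    grw [hi Q, hQ, Subgroup.card_map_le_card]
  have hBP : B.map φ ≤ (P : Subgroup H).map φ := by
    rintro _ ⟨b, hb, rfl⟩
    obtain ⟨m, hm, t, ht⟩ := hR.exists_zpow_map_eq φ b
    have hmem : g.rangeRestrict (b ^ m) ∈ (Q : Subgroup g.range) :=
      Q.mem_of_mem_normal_of_comm hn hc (B.zpow_mem hb m) (t := t) (by rw [← map_pow, ht, map_one])
    rw [hQ, ← Subgroup.mem_comap, Subgroup.comap_map_eq,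
      sup_eq_left.2 (hgker.le_sylow_of_normal P)] at hmem
    exact ⟨_, hmem, hm⟩
  have : Finite R := Finite.of_surjective φ hφ
  calc Nat.card R = Nat.card (B.map φ) * (B.map φ).index := (Subgroup.card_mul_index _).symm
    _ ≤ Nat.card (P : Subgroup H) * (J * Nat.card (P : Subgroup H) ^ e) := by
      refine Nat.mul_le_mul ?_ ?_
      · exact (Subgroup.card_le_of_le hBP).trans (Subgroup.card_map_le_card _ _)
      · exact (Nat.le_of_dvd (Nat.pos_of_ne_zero Subgroup.FiniteIndex.index_ne_zero)
          (B.index_map_dvd hφ)).trans hBi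
    _ = J * Nat.card (P : Subgroup H) ^ (e + 1) := by ring

/-- In a finite group `G` embedded in the product of two groups by homomorphisms `f` and `g`, every
maximal `p`-subgroup of `G` polynomially bounds some maximal `p`-subgroup of the range of `f`. -/
theorem IsPJordanWith.exists_sylow_range_card_le {p J e : ℕ} {Γ₁ Γ₂ G : Type*} [Group Γ₁]
    [Group Γ₂] [Group G] [Finite G] (h : IsPJordanWith p J e Γ₂) (f : G →* Γ₁) (g : G →* Γ₂)
    (hinj : Function.Injective (f.prod g)) (P : Sylow p G) :
    ∃ R : Sylow p f.range,
      Nat.card (R : Subgroup f.range) ≤ J * Nat.card (P : Subgroup G) ^ (e + 1) := by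
  obtain ⟨R, hPR⟩ := (P.isPGroup'.map f.rangeRestrict).exists_le_sylow
  let H := (R : Subgroup f.range).comap f.rangeRestrict
  have hPH : (P : Subgroup G) ≤ H := Subgroup.map_le_iff_le_comap.1 hPR
  refine ⟨R, ?_⟩
  have hinjH : Function.Injective
      ((f.rangeRestrict.subgroupComap (R : Subgroup f.range)).prod (g.comp H.subtype)) := by
    intro x y hxy
    obtain ⟨hf, hg⟩ := Prod.ext_iff.1 hxy
    exact Subtype.ext (hinj (Prod.ext (congrArg (fun z : R => ((z : f.range) : Γ₁)) hf) hg))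
  have key := h.card_le_of_isPGroup R.isPGroup' (f.rangeRestrict.subgroupComap R)
    (f.rangeRestrict.subgroupComap_surjective_of_surjective _ f.rangeRestrict_surjective)
    (g.comp H.subtype) hinjH
    (P.subtype hPH)
  rwa [Sylow.coe_subtype, Nat.card_congr (Subgroup.subgroupOfEquivOfLe hPH).toEquiv] at key

/-- The direct product of two `p`-Jordan groups is `p`-Jordan. -/
theorem IsPJordan.prod {p : ℕ} {Γ₁ Γ₂ : Type*} [Group Γ₁] [Group Γ₂]
    (h₁ : IsPJordan p Γ₁) (h₂ : IsPJordan p Γ₂) : IsPJordan p (Γ₁ × Γ₂) := by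
  obtain ⟨J₁, e₁, h₁⟩ := h₁
  obtain ⟨J₂, e₂, h₂⟩ := h₂
  refine ⟨J₁ * J₂ ^ e₁ * (J₂ * J₁ ^ e₂), (e₂ + 1) * e₁ + (e₁ + 1) * e₂, fun G _ => ?_⟩
  let f := (MonoidHom.fst Γ₁ Γ₂).comp G.subtype
  let g := (MonoidHom.snd Γ₁ Γ₂).comp G.subtype
  obtain ⟨A, hAn, hAc, hAi⟩ := h₁.exists_normal f
  obtain ⟨B, hBn, hBc, hBi⟩ := h₂.exists_normal g
  refine ⟨A ⊓ B, inferInstance, fun a b => ?_, fun P => ?_⟩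
  · exact Subtype.ext (Subtype.ext (Prod.ext (hAc a a.2.1 b b.2.1) (hBc a a.2.2 b b.2.2)))
  · obtain ⟨R, hR⟩ := h₂.exists_sylow_range_card_le f g (fun x y hxy => Subtype.ext hxy) P
    obtain ⟨S, hS⟩ := h₁.exists_sylow_range_card_le g f
      (fun x y hxy => Subtype.ext (Prod.swap_injective hxy)) P
    grw [Subgroup.index_inf_le, hAi R, hBi S, hR, hS]
    exact le_of_eq (by ring)

theorem IsPJordan.of_subsingleton (p : ℕ) (Γ : Type*) [Group Γ] [Subsingleton Γ] :
    IsPJordan p Γ :=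
  ⟨1, 0, fun _ _ => ⟨⊤, inferInstance, fun _ _ => Subsingleton.elim _ _, fun _ => by simp⟩⟩

/-- A finite direct product of `p`-Jordan groups is `p`-Jordan. -/
theorem IsPJordan.pi {p : ℕ} {ι : Type*} [Finite ι] (G : ι → Type*) [∀ i, Group (G i)]
    (h : ∀ i, IsPJordan p (G i)) : IsPJordan p (∀ i, G i) := by
  induction ι using Finite.induction_empty_option with
  | of_equiv e ih =>
    refine (ih (fun a => G (e a)) fun a => h (e a)).of_injective
      (MonoidHom.pi fun a => Pi.evalMonoidHom G (e a)) fun x y hxy => ?_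
    exact funext (e.surjective.forall.2 (congrFun hxy))
  | h_empty => exact .of_subsingleton p _
  | h_option ih =>
    refine ((h none).prod (ih (fun a => G (some a)) fun a => h (some a))).of_injective
      ((Pi.evalMonoidHom G none).prod (MonoidHom.pi fun a => Pi.evalMonoidHom G (some a)))
      fun x y hxy => funext fun i => ?_
    cases i with
    | none => exact congrArg Prod.fst hxy
    | some a => exact congrFun (congrArg Prod.snd hxy) a

/-- The direct product of two `p`-Jordan groups is `p`-Jordan; consequently, any finite
direct product of `p`-Jordan groups is `p`-Jordan. -/
theorem isPJordan_prod (p : ℕ) (Γ₁ Γ₂ : Type*) [Group Γ₁] [Group Γ₂]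
    (h1 : IsPJordan p Γ₁) (h2 : IsPJordan p Γ₂) :
    IsPJordan p (Γ₁ × Γ₂) ∧
      ∀ (ι : Type*) [Finite ι] (G : ι → Type*) [∀ i, Group (G i)],
        (∀ i, IsPJordan p (G i)) → IsPJordan p (∀ i, G i) := by
  exact ⟨h1.prod h2, fun _ _ G _ h => .pi G h⟩
end

section
/- Let n be a positive integer and p a prime. The group GL_n over an algebraic closure of the finite field F_p is p-Jordan; that is, there exist constants J(n) and e(n) such that every finite subgroup G ⊆ GL_n(F̄_p) contains a normal abelian subgroup A with [G : A] ≤ J(n) · |G_p|^{e(n)}, where G_p is a Sylow p-subgroup of G. -/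
open AlgebraicGeometry CategoryTheory TopologicalSpace MvPolynomial Matrix
section Modular

variable {K G : Type*} [Field K]

theorem comp_mem_pow {X : Submodule K (G → K)} {σ : G → G}
    (h : ∀ c ∈ X, (fun x => c (σ x)) ∈ X) (m : ℕ) : ∀ c ∈ X ^ m, (fun x => c (σ x)) ∈ X ^ m := by
  let φ : (G → K) →ₐ[K] (G → K) := AlgHom.pi fun x => Pi.evalAlgHom K _ (σ x)
  have h1 : X.map φ.toLinearMap ≤ X := by
    rintro _ ⟨c, hc, rfl⟩
    exact h c hc
  intro c hc
  have h2 : (X ^ m).map φ.toLinearMap ≤ X ^ m := by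
    rw [Submodule.map_pow]
    exact pow_le_pow_left' h1 m
  exact h2 ⟨c, hc, rfl⟩

theorem mul_mem_pow_add {X : Submodule K (G → K)} {a b : ℕ} {c d : G → K} (hc : c ∈ X ^ a)
    (hd : d ∈ X ^ b) : c * d ∈ X ^ (a + b) := by
  rw [pow_add]
  exact Submodule.mul_mem_mul hc hd

theorem prod_mem_pow {ι : Type*} {X : Submodule K (G → K)} {a : ℕ} (s : Finset ι) (c : ι → G → K)
    (hc : ∀ i ∈ s, c i ∈ X ^ a) : ∏ i ∈ s, c i ∈ X ^ (a * s.card) := by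
  classical
  induction s using Finset.induction_on with
  | empty => simpa using ⟨1, map_one _⟩
  | insert i s hi ih =>
    rw [Finset.prod_insert hi, Finset.card_insert_of_notMem hi, mul_add, mul_one, add_comm]
    exact mul_mem_pow_add (hc i (by simp)) (ih fun j hj => hc j (by simp [hj]))

/-- A finite-dimensional function space has a reproducing kernel. -/
theorem exists_reproducing_kernel [Fintype G] (W : Submodule K (G → K)) :
    ∃ k : G → G → K, (∀ y, k y ∈ W) ∧ ∀ c ∈ W, ∀ x, c x = ∑ y, c y * k y x := by
  classical
  obtain ⟨π, hπ⟩ := LinearMap.exists_leftInverse_of_injective W.subtype W.ker_subtype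
  refine ⟨fun y => π (Pi.single y 1), fun y => (π _).2, fun c hc x => ?_⟩
  have h1 : π c = ⟨c, hc⟩ := LinearMap.congr_fun hπ ⟨c, hc⟩
  have h2 : c = ∑ y, c y • (Pi.single y 1 : G → K) := by
    ext x; simp [Pi.single_apply]
  have h3 : c = ∑ y, c y • (π (Pi.single y 1) : G → K) := by
    conv_lhs => rw [← show ((π c : W) : G → K) = c by rw [h1], h2]
    simp
  simpa using congrFun h3 x

variable [Group G]

/-- A space of functions on a group containing the constants, separating points from the identity
and stable under translations and inversion. -/
structure IsRegularSpace (X : Submodule K (G → K)) : Prop where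
  one_le : 1 ≤ X
  left : ∀ g : G, ∀ c ∈ X, (fun x => c (g * x)) ∈ X
  right : ∀ g : G, ∀ c ∈ X, (fun x => c (x * g)) ∈ X
  inv : ∀ c ∈ X, (fun x => c x⁻¹) ∈ X
  separates : ∀ g : G, (∀ c ∈ X, c g = c 1) → g = 1

namespace IsRegularSpace

variable {X : Submodule K (G → K)}

theorem pow_mono (hX : IsRegularSpace X) {a b : ℕ} (h : a ≤ b) : X ^ a ≤ X ^ b :=
  pow_le_pow_right' hX.one_le h

theorem pow_left (hX : IsRegularSpace X) (g : G) {m : ℕ} {c : G → K} (hc : c ∈ X ^ m) :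
    (fun x => c (g * x)) ∈ X ^ m :=
  comp_mem_pow (hX.left g) m c hc

theorem pow_right (hX : IsRegularSpace X) (g : G) {m : ℕ} {c : G → K} (hc : c ∈ X ^ m) :
    (fun x => c (x * g)) ∈ X ^ m :=
  comp_mem_pow (hX.right g) m c hc

theorem pow_inv (hX : IsRegularSpace X) {m : ℕ} {c : G → K} (hc : c ∈ X ^ m) :
    (fun x => c x⁻¹) ∈ X ^ m :=
  comp_mem_pow hX.inv m c hc

theorem exists_delta (hX : IsRegularSpace X) [Finite G] (P : Subgroup G) :
    ∃ δ ∈ X ^ Nat.card P, δ 1 = 1 ∧ ∀ y ∈ P, y ≠ 1 → δ y = 0 := by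
  classical
  have := Fintype.ofFinite P
  have h : ∀ y : P, ∃ c ∈ X, c 1 = 1 ∧ ((y : G) ≠ 1 → c y = 0) := by
    intro y
    by_cases hy : (y : G) = 1
    · exact ⟨1, Submodule.one_le.mp hX.one_le, rfl, fun h => absurd hy h⟩
    · have : ¬ ∀ c ∈ X, c y = c 1 := fun h => hy (hX.separates _ h)
      push Not at this
      obtain ⟨c, hc, hne⟩ := this
      have hne' : c 1 - c y ≠ 0 := sub_ne_zero.mpr hne.symm
      refine ⟨(c 1 - c y)⁻¹ • (c - c y • 1), ?_, ?_, ?_⟩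
      · exact X.smul_mem _ (X.sub_mem hc (X.smul_mem _ (Submodule.one_le.mp hX.one_le)))
      · simp [hne']
      · simp
  choose c hcX hc1 hc0 using h
  refine ⟨∏ y, c y, ?_, ?_, ?_⟩
  · have := prod_mem_pow (a := 1) (X := X) Finset.univ c (fun i _ => by simpa using hcX i)
    simpa [Nat.card_eq_fintype_card] using this
  · simp [Finset.prod_apply, hc1]
  · intro y hy hy1
    rw [Finset.prod_apply]
    exact Finset.prod_eq_zero (Finset.mem_univ (⟨y, hy⟩ : P)) (hc0 ⟨y, hy⟩ hy1)

/-- The constant function `1` is a transfer from the trivial subgroup of a function of low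
degree. -/
theorem exists_transfer_eq_one (hX : IsRegularSpace X) [Finite G] (P : Subgroup G) [Fintype P] :
    ∃ f ∈ X ^ (3 * Nat.card P ^ 2), ∀ g, ∑ x : P, f (g * x) = 1 := by
  classical
  have := Fintype.ofFinite G
  set q := Nat.card P with hq
  have hq' : Fintype.card P = q := by rw [hq, Nat.card_eq_fintype_card]
  have hq1 : 1 ≤ q := Nat.card_pos
  obtain ⟨δ, hδ, hδ1, hδ0⟩ := hX.exists_delta P
  obtain ⟨k, hk, hrep⟩ := exists_reproducing_kernel (X ^ q)
  set a : G → G → K := fun y g => ∑ x : P, k y (g * x) with ha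
  set b : G → G → K := fun y g => δ (g⁻¹ * y) with hb
  have haX : ∀ y, a y ∈ X ^ q := by
    intro y
    have : a y = ∑ x : P, fun g => k y (g * x) := by ext g; simp [ha]
    rw [this]
    exact Submodule.sum_mem _ fun x _ => hX.pow_right _ (hk y)
  have hbX : ∀ y, b y ∈ X ^ q := fun y => hX.pow_inv (hX.pow_right y hδ)
  have hbX' : ∀ y (x : P), (fun g => b y (g * x)) ∈ X ^ q := fun y x => hX.pow_right _ (hbX y)
  have hainv : ∀ y g (x : P), a y (g * x) = a y g := by
    intro y g x
    simp only [ha]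
    exact Fintype.sum_equiv (Equiv.mulLeft x) _ _ fun z => by simp [mul_assoc]
  have hab : ∀ g, ∑ y, a y g * b y g = 1 := by
    intro g
    have h1 : ∀ x : P, ∑ y, k y (g * x) * b y g = δ x := by
      intro x
      have := hrep _ (hX.pow_left g⁻¹ hδ) (g * x)
      simp only [inv_mul_cancel_left] at this
      rw [this]
      exact Finset.sum_congr rfl fun y _ => mul_comm _ _
    calc ∑ y, a y g * b y g = ∑ x : P, ∑ y, k y (g * x) * b y g := by
          rw [Finset.sum_comm]
          simp [ha, Finset.sum_mul]
      _ = ∑ x : P, δ x := by simp [h1]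
      _ = δ (1 : P) := Finset.sum_eq_single 1
          (fun x _ hx => hδ0 x x.2 (by simpa using hx)) (by simp)
      _ = 1 := by simpa using hδ1
  have key : ∀ s : Finset G, ∃ f ∈ X ^ (3 * q ^ 2),
      ∀ g, ∏ x : P, ∑ y ∈ s, a y g * b y (g * x) = ∑ x : P, f (g * x) := by
    intro s
    induction s using Finset.induction_on with
    | empty =>
      refine ⟨0, Submodule.zero_mem _, fun g => ?_⟩
      simp only [Finset.sum_empty, Pi.zero_apply, Finset.sum_const_zero]
      exact Finset.prod_eq_zero (Finset.mem_univ 1) rfl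
    | insert i s hi ih =>
      obtain ⟨f, hf, hfs⟩ := ih
      set A : P → G → K := fun x g => ∑ y ∈ s, a y g * b y (g * x) with hA
      have hAX : ∀ x, A x ∈ X ^ (q + q) := by
        intro x
        have : A x = ∑ y ∈ s, a y * fun g => b y (g * x) := by ext g; simp [hA]
        rw [this]
        exact Submodule.sum_mem _ fun y _ => mul_mem_pow_add (haX y) (hbX' y x)
      set w : G → K := fun g => ∑ Z ∈ Finset.univ.powerset.erase (∅ : Finset P),
        a i g ^ (Z.card - 1) * ((∏ x ∈ Z, b i (g * x)) * ∏ x ∈ Finset.univ \ Z, A x g) with hw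
      have hwX : w ∈ X ^ (2 * q ^ 2) := by
        have : w = ∑ Z ∈ Finset.univ.powerset.erase (∅ : Finset P), a i ^ (Z.card - 1) *
            ((∏ x ∈ Z, fun g => b i (g * x)) * ∏ x ∈ Finset.univ \ Z, A x) := by
          ext g; simp [hw]
        rw [this]
        refine Submodule.sum_mem _ fun Z hZ => ?_
        have hZ1 : Z.card ≤ q := hq' ▸ Z.card_le_univ
        have hc : (Finset.univ \ Z).card = q - Z.card := by
          rw [Finset.card_sdiff_of_subset (Finset.subset_univ _), Finset.card_univ, hq']
        have h1 : a i ^ (Z.card - 1) ∈ X ^ (q * (Z.card - 1)) := by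
          rw [pow_mul]; exact Submodule.pow_mem_pow _ (haX i) _
        have h2 := prod_mem_pow (X := X) Z (fun x : P => fun g => b i (g * x)) (fun x _ => hbX' i x)
        have h3 := prod_mem_pow (X := X) (Finset.univ \ Z) A (fun x _ => hAX x)
        refine hX.pow_mono ?_ (mul_mem_pow_add h1 (mul_mem_pow_add h2 h3))
        rw [hc]
        obtain ⟨r, hr⟩ := Nat.exists_eq_add_of_le hZ1
        have : q - Z.card = r := by omega
        rw [this]
        have h4 : Z.card - 1 ≤ Z.card := Nat.sub_le _ _
        have h5 : q * (Z.card - 1) ≤ q * Z.card := Nat.mul_le_mul_left _ h4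
        have h6 : q * q = q * Z.card + q * r := by rw [← mul_add, ← hr]
        nlinarith
      have hwinv : ∀ g (x : P), w (g * x) = w g := by
        intro g x
        have hAinv : ∀ z : P, A z (g * x) = A (x * z) g := by
          intro z
          simp [hA, hainv, mul_assoc]
        simp only [hw, hainv, hAinv]
        refine Finset.sum_bij' (fun Z _ => Z.map (Equiv.mulLeft x).toEmbedding)
          (fun Z _ => Z.map (Equiv.mulLeft x⁻¹).toEmbedding) ?_ ?_ ?_ ?_ ?_
        · intro Z hZ
          simpa using hZ
        · intro Z hZ
          simpa using hZ
        · intro Z hZ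
          ext z; simp
        · intro Z hZ
          ext z; simp
        · intro Z hZ
          have h1 : Finset.univ \ Z.map (Equiv.mulLeft x).toEmbedding =
              (Finset.univ \ Z).map (Equiv.mulLeft x).toEmbedding := by
            ext z; simp
          rw [h1]
          simp [mul_assoc]
      refine ⟨f + k i * w, Submodule.add_mem _ hf
        (hX.pow_mono (by nlinarith) (mul_mem_pow_add (hk i) hwX)), fun g => ?_⟩
      have h1 : ∏ x : P, ∑ y ∈ insert i s, a y g * b y (g * x) =
          ∏ x : P, (a i g * b i (g * x) + A x g) := by
        simp [Finset.sum_insert hi, hA]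
      have h2 : ∏ x : P, (a i g * b i (g * x) + A x g) = a i g * w g + ∏ x : P, A x g := by
        rw [Finset.prod_add, ← Finset.sum_erase_add _ _ (Finset.empty_mem_powerset _)]
        congr 1
        · rw [hw, Finset.mul_sum]
          refine Finset.sum_congr rfl fun Z hZ => ?_
          have hZ0 : Z.card ≠ 0 := by
            simpa using hZ
          rw [Finset.prod_mul_distrib, Finset.prod_const]
          obtain ⟨c, hc⟩ := Nat.exists_eq_succ_of_ne_zero hZ0
          rw [hc]
          simp only [Nat.succ_eq_add_one, Nat.add_sub_cancel]
          ring
        · simp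
      rw [h1, h2, hfs g]
      simp only [Pi.add_apply, Pi.mul_apply, hwinv, Finset.sum_add_distrib, ← Finset.sum_mul]
      rw [add_comm]
  obtain ⟨f, hf, hfs⟩ := key Finset.univ
  refine ⟨f, hf, fun g => ?_⟩
  rw [← hfs g]
  refine Finset.prod_eq_one fun x _ => ?_
  have := hab (g * x)
  simpa only [hainv] using this

theorem exists_sum_eq_one (hX : IsRegularSpace X) [Fintype G] (P : Subgroup G)
    (hP : (P.index : K) ≠ 0) :
    ∃ f ∈ X ^ (3 * Nat.card P ^ 2), ∑ g, f g = 1 := by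
  classical
  have := Fintype.ofFinite P
  have := Fintype.ofFinite (G ⧸ P)
  obtain ⟨f, hf, hf1⟩ := hX.exists_transfer_eq_one P
  have h : ∑ g, f g = P.index := by
    rw [← Finset.sum_fiberwise (g := (QuotientGroup.mk : G → G ⧸ P))]
    have : ∀ c : G ⧸ P, ∑ g with QuotientGroup.mk g = c, f g = 1 := by
      intro c
      rw [← hf1 c.out]
      refine (Finset.sum_bij (fun (x : P) _ => c.out * (x : G)) ?_ ?_ ?_ ?_).symm
      · intro x _
        simp
      · intro x _ y _ h
        exact Subtype.ext (mul_left_cancel h)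
      · intro g hg
        have hg' : (QuotientGroup.mk c.out : G ⧸ P) = QuotientGroup.mk g := by simp_all
        exact ⟨⟨c.out⁻¹ * g, QuotientGroup.eq.mp hg'⟩, Finset.mem_univ _, by simp⟩
      · simp
    simp [this, Subgroup.index, Nat.card_eq_fintype_card]
  refine ⟨(P.index : K)⁻¹ • f, Submodule.smul_mem _ _ hf, ?_⟩
  simp [← Finset.mul_sum, h, hP]

end IsRegularSpace
end Modular

theorem finrank_span_range_pow_le {K A ι : Type*} [Field K] [CommRing A] [Algebra K A] [Fintype ι]
    (v : ι → A) (m : ℕ) :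
    Module.finrank K ↥((Submodule.span K (Set.range v)) ^ m) ≤ (m + 1) ^ Fintype.card ι := by
  classical
  have h : Submodule.span K (Set.range v) ^ m ≤
      Submodule.span K {a | ∃ α : ι → ℕ, ∑ i, α i = m ∧ ∏ i, v i ^ α i = a} := by
    induction m with
    | zero =>
      rw [pow_zero, Submodule.one_le]
      exact Submodule.subset_span ⟨0, by simp⟩
    | succ m ih =>
      rw [pow_succ]
      refine (mul_le_mul_left ih _).trans ?_
      rw [Submodule.span_mul_span]
      refine Submodule.span_mono ?_
      rintro _ ⟨_, ⟨α, hα, rfl⟩, _, ⟨i, rfl⟩, rfl⟩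
      refine ⟨α + Pi.single i 1, ?_, ?_⟩
      · simp [Finset.sum_add_distrib, hα]
      · simp only [Pi.add_apply, pow_add, Finset.prod_mul_distrib]
        simp [Pi.single_apply, pow_ite]
  have h' : Submodule.span K (Set.range v) ^ m ≤
      Submodule.span K (Set.range fun α : ι → Fin (m + 1) => ∏ i, v i ^ (α i : ℕ)) := by
    refine h.trans (Submodule.span_mono ?_)
    rintro _ ⟨α, hα, rfl⟩
    refine ⟨fun i => ⟨α i, Nat.lt_succ_of_le ?_⟩, rfl⟩
    exact hα ▸ Finset.single_le_sum (fun _ _ => Nat.zero_le _) (Finset.mem_univ i)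
  have := Module.Finite.span_of_finite K
    (Set.finite_range fun α : ι → Fin (m + 1) => ∏ i, v i ^ (α i : ℕ))
  refine (Submodule.finrank_mono h').trans ((finrank_range_le_card _).trans ?_)
  simp

theorem exists_pos_pow_isIdempotentElem {M : Type*} [Monoid M] [Finite M] (a : M) :
    ∃ n, 0 < n ∧ IsIdempotentElem (a ^ n) := by
  obtain ⟨i, j, hij, h⟩ : ∃ i j : ℕ, i < j ∧ a ^ i = a ^ j := by
    obtain ⟨i, j, hne, h⟩ := Finite.exists_ne_map_eq_of_infinite (fun n : ℕ => a ^ n)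
    rcases hne.lt_or_gt with h' | h'
    · exact ⟨i, j, h', h⟩
    · exact ⟨j, i, h', h.symm⟩
  obtain ⟨d, rfl⟩ := Nat.exists_eq_add_of_lt hij
  have h1 : ∀ k n, i ≤ n → a ^ (n + k * (d + 1)) = a ^ n := by
    intro k n hn
    induction k with
    | zero => simp
    | succ k ih =>
      obtain ⟨r, rfl⟩ := Nat.exists_eq_add_of_le hn
      have : i + r + (k + 1) * (d + 1) = (i + d + 1) + (r + k * (d + 1)) := by ring
      rw [this, pow_add, ← h, ← pow_add, ← ih]
      congr 1
      ring
  refine ⟨(i + 1) * (d + 1), by positivity, ?_⟩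
  rw [IsIdempotentElem, ← pow_add]
  exact h1 (i + 1) _ (by nlinarith)

theorem IsRegularSpace.exists_invariant_idempotent {K G : Type*} [Field K] [Finite K] [Group G]
    [Fintype G] [DecidableEq G] {X : Submodule K (G → K)} (hX : IsRegularSpace X) (P : Subgroup G)
    (hP : (P.index : K) ≠ 0) (m : ℕ) :
    ∃ B : Matrix G G K, IsIdempotentElem B ∧ (∀ g x y, B (g * x) (g * y) = B x y) ∧
      (∀ x, B x ∈ X ^ (3 * Nat.card P ^ 2 + m)) ∧ ∀ c ∈ X ^ m, B *ᵥ c = c := by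
  obtain ⟨f, hf, hf1⟩ := hX.exists_sum_eq_one P hP
  obtain ⟨k, hk, hrep⟩ := exists_reproducing_kernel (X ^ m)
  set d := 3 * Nat.card P ^ 2
  set t : G → K := fun x => ∑ y, f (x⁻¹ * y) * k y (x⁻¹ * y) with ht
  have htX : t ∈ X ^ (d + m) := by
    have : t = ∑ y, fun x => (fun z => (f * k y) (z * y)) x⁻¹ := by
      ext x; simp [ht]
    rw [this]
    exact Submodule.sum_mem _ fun y _ =>
      hX.pow_inv (hX.pow_right y (mul_mem_pow_add hf (hk y)))
  have htc : ∀ c ∈ X ^ m, ∑ x, t x * c x = c 1 := by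
    intro c hc
    calc ∑ x, t x * c x = ∑ x, ∑ z, f z * (c x * k (x * z) z) := by
          refine Finset.sum_congr rfl fun x _ => ?_
          rw [ht, Finset.sum_mul]
          refine Fintype.sum_equiv (Equiv.mulLeft x⁻¹) _ _ fun y => ?_
          simp; ring
      _ = ∑ z, f z * ∑ x, c x * k (x * z) z := by
          rw [Finset.sum_comm]; simp [Finset.mul_sum]
      _ = ∑ z, f z * c 1 := by
          refine Finset.sum_congr rfl fun z _ => ?_
          have := hrep _ (hX.pow_right z⁻¹ hc) z
          simp only [mul_inv_cancel] at this
          rw [this]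
          congr 1
          exact Fintype.sum_equiv (Equiv.mulRight z) _ _ fun y => by simp
      _ = c 1 := by rw [← Finset.sum_mul, hf1, one_mul]
  set T : Matrix G G K := of fun x y => t (x⁻¹ * y) with hT
  have hpow : ∀ n, (∀ g x y, (T ^ (n + 1)) (g * x) (g * y) = (T ^ (n + 1)) x y) ∧
      (∀ x, (T ^ (n + 1)) x ∈ X ^ (d + m)) ∧ ∀ c ∈ X ^ m, (T ^ (n + 1)) *ᵥ c = c := by
    have hT1 : ∀ g x y, T (g * x) (g * y) = T x y := by
      intro g x y; simp [hT, mul_assoc]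
    have hT3 : ∀ c ∈ X ^ m, T *ᵥ c = c := by
      intro c hc
      ext x
      rw [mulVec, dotProduct]
      have := htc _ (hX.pow_left x hc)
      simp only [mul_one] at this
      rw [← this]
      exact Fintype.sum_equiv (Equiv.mulLeft x⁻¹) _ _ fun y => by simp [hT]
    intro n
    induction n with
    | zero =>
      simp only [zero_add, pow_one]
      exact ⟨hT1, fun x => hX.pow_left x⁻¹ htX, hT3⟩
    | succ n ih =>
      obtain ⟨h1, h2, h3⟩ := ih
      refine ⟨fun g x y => ?_, fun x => ?_, fun c hc => ?_⟩
      · rw [pow_succ', mul_apply, mul_apply]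
        exact (Fintype.sum_equiv (Equiv.mulLeft g) _ _ fun z => by simp [h1, hT1]).symm
      · have : (T ^ (n + 1 + 1)) x = ∑ z, T x z • (T ^ (n + 1)) z := by
          ext y; simp [pow_succ' T (n + 1), mul_apply]
        rw [this]
        exact Submodule.sum_mem _ fun z _ => Submodule.smul_mem _ _ (h2 z)
      · rw [pow_succ', ← mulVec_mulVec, h3 c hc, hT3 c hc]
  obtain ⟨n, hn, hid⟩ := exists_pos_pow_isIdempotentElem T
  obtain ⟨n, rfl⟩ := Nat.exists_eq_succ_of_ne_zero hn.ne'
  exact ⟨T ^ (n + 1), hid, hpow n⟩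

section Lifting

variable {O K n : Type*} [CommRing O] [Field K] [Fintype n]

theorem Matrix.mul_mem_entries {J J' : Ideal O} {M N : Matrix n n O} (hM : ∀ i j, M i j ∈ J)
    (hN : ∀ i j, N i j ∈ J') (i j : n) : (M * N) i j ∈ J * J' := by
  rw [mul_apply]
  exact Submodule.sum_mem _ fun k _ => Ideal.mul_mem_mul (hM i k) (hN k j)

theorem Matrix.mul_mem_entries_right {J : Ideal O} {M : Matrix n n O} (hM : ∀ i j, M i j ∈ J)
    (N : Matrix n n O) (i j : n) : (M * N) i j ∈ J := by
  rw [mul_apply]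
  exact Submodule.sum_mem _ fun k _ => Ideal.mul_mem_right _ _ (hM i k)

theorem Matrix.mul_mem_entries_left {J : Ideal O} {M : Matrix n n O} (hM : ∀ i j, M i j ∈ J)
    (N : Matrix n n O) (i j : n) : (N * M) i j ∈ J := by
  rw [mul_apply]
  exact Submodule.sum_mem _ fun k _ => Ideal.mul_mem_left _ _ (hM k j)

variable [DecidableEq n]

/-- Idempotent matrices lift along the residue map of an adically complete ring, compatibly with
simultaneous permutations of rows and columns. -/
theorem exists_isIdempotentElem_lift (r : O →+* K) (hr : Function.Surjective r)
    [IsAdicComplete (RingHom.ker r) O] (B : Matrix n n K) (hB : IsIdempotentElem B) :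
    ∃ A : Matrix n n O, IsIdempotentElem A ∧ A.map r = B ∧
      ∀ σ : Equiv.Perm n, B.submatrix σ σ = B → A.submatrix σ σ = A := by
  set I := RingHom.ker r
  set a0 : Matrix n n O := B.map (Function.surjInv hr) with ha0
  have hra0 : a0.map r = B := by
    ext i j; simp [ha0, Function.surjInv_eq hr]
  let a : ℕ → Matrix n n O := fun k => (fun x => 3 * x ^ 2 - 2 * x ^ 3)^[k] a0
  have hsucc : ∀ k, a (k + 1) = 3 * a k ^ 2 - 2 * a k ^ 3 := fun k =>
    Function.iterate_succ_apply' _ _ _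
  have hu : ∀ k i j, (a k ^ 2 - a k) i j ∈ I ^ (k + 1) := by
    intro k
    induction k with
    | zero =>
      intro i j
      have : (a0 ^ 2 - a0).map r = 0 := by
        rw [Matrix.map_sub _ (by simp), pow_two, Matrix.map_mul, hra0, hB.eq, sub_self]
      rw [zero_add, pow_one]
      exact congrFun (congrFun this i) j
    | succ k ih =>
      have : a (k + 1) ^ 2 - a (k + 1) =
          ((a k ^ 2 - a k) * (a k ^ 2 - a k)) * (4 * a k ^ 2 - 4 * a k - 3) := by
        rw [hsucc]; noncomm_ring
      intro i j
      rw [this]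
      refine Ideal.pow_le_pow_right (by omega : k + 1 + 1 ≤ (k + 1) + (k + 1)) ?_
      rw [pow_add]
      exact mul_mem_entries_right (mul_mem_entries ih ih) _ i j
  have hd : ∀ k i j, (a k - a (k + 1)) i j ∈ I ^ k := by
    intro k i j
    have : a k - a (k + 1) = (a k ^ 2 - a k) * (2 * a k - 1) := by
      rw [hsucc]; noncomm_ring
    rw [this]
    exact Ideal.pow_le_pow_right (Nat.le_succ k) (mul_mem_entries_right (hu k) _ i j)
  have hcau : ∀ i j {m l : ℕ}, m ≤ l → a m i j ≡ a l i j [SMOD (I ^ m • ⊤ : Submodule O O)] := by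
    intro i j m l hml
    induction l, hml using Nat.le_induction with
    | base => exact SModEq.rfl
    | succ l hml ih =>
      refine ih.trans (SModEq.sub_mem.mpr ?_)
      rw [smul_eq_mul, Ideal.mul_top]
      exact Ideal.pow_le_pow_right hml (hd l i j)
  choose A hA using fun i j => IsPrecomplete.prec IsAdicComplete.toIsPrecomplete (hcau i j)
  have hA' : ∀ k i j, (a k - of A) i j ∈ I ^ k := by
    intro k i j
    have := SModEq.sub_mem.mp (hA i j k)
    rwa [smul_eq_mul, Ideal.mul_top] at this
  have hzero : ∀ x : O, (∀ k, x ∈ I ^ k) → x = 0 := by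
    intro x hx
    refine IsHausdorff.haus (I := I) inferInstance x fun k => ?_
    rw [SModEq.zero, smul_eq_mul, Ideal.mul_top]
    exact hx k
  refine ⟨of A, ?_, ?_, ?_⟩
  · rw [IsIdempotentElem, ← sub_eq_zero]
    ext i j
    refine hzero _ fun k => ?_
    have : of A * of A - of A = (a k ^ 2 - a k) - (a k - of A) * of A - a k * (a k - of A)
        + (a k - of A) := by noncomm_ring
    rw [this]
    exact add_mem (sub_mem (sub_mem (Ideal.pow_le_pow_right (Nat.le_succ k) (hu k i j))
      (mul_mem_entries_right (hA' k) _ i j)) (mul_mem_entries_left (hA' k) _ i j)) (hA' k i j)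
  · ext i j
    have h1 : (a0 - a 1) i j ∈ I := by
      have : a0 - a 1 = (a 0 ^ 2 - a 0) * (2 * a 0 - 1) := by
        rw [hsucc]; change a 0 - _ = _; noncomm_ring
      rw [this]
      simpa using mul_mem_entries_right (hu 0) _ i j
    have h2 : (a0 - of A) i j ∈ I := by
      have := add_mem h1 (by simpa using hA' 1 i j)
      simpa using this
    have h3 : r ((a0 - of A) i j) = 0 := h2
    rw [← hra0]
    rw [Matrix.sub_apply, map_sub] at h3
    exact (sub_eq_zero.mp h3).symm
  · intro σ hσ
    have hk : ∀ k, (a k).submatrix σ σ = a k := by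
      intro k
      induction k with
      | zero =>
        change (B.map _).submatrix σ σ = B.map _
        conv_rhs => rw [← hσ]
        rfl
      | succ k ih =>
        have h2 : ∀ M N : Matrix n n O, (M * N).submatrix σ σ = M.submatrix σ σ * N.submatrix σ σ :=
          fun M N => (submatrix_mul_equiv M N σ σ σ).symm
        have h3 : ∀ M : Matrix n n O, M.submatrix σ σ = M →
            (3 * M ^ 2 - 2 * M ^ 3).submatrix σ σ = 3 * M ^ 2 - 2 * M ^ 3 := by
          intro M hM
          have e : 3 * M ^ 2 - 2 * M ^ 3 = M * M + M * M + M * M - (M * M * M + M * M * M) := by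
            noncomm_ring
          rw [e, submatrix_sub, submatrix_add, submatrix_add, submatrix_add]
          simp only [Pi.sub_apply, Pi.add_apply, h2, hM]
        rw [hsucc]
        exact h3 _ ih
    rw [← sub_eq_zero]
    ext i j
    refine hzero _ fun k => ?_
    have : ((of A).submatrix σ σ - of A) i j =
        (a k - of A) i j - (a k - of A) (σ i) (σ j) := by
      have := congrFun (congrFun (hk k) i) j
      simp only [submatrix_apply] at this
      simp [this]
    rw [this]
    exact sub_mem (hA' k _ _) (hA' k _ _)

theorem isUnit_of_map_eq_one (r : O →+* K) [IsAdicComplete (RingHom.ker r) O] (M : Matrix n n O)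
    (hM : M.map r = 1) : IsUnit M := by
  rw [isUnit_iff_isUnit_det]
  have h1 : r M.det = 1 := by
    rw [RingHom.map_det, RingHom.mapMatrix_apply, hM, det_one]
  have h2 : M.det - 1 ∈ Ideal.jacobson (⊥ : Ideal O) :=
    IsAdicComplete.le_jacobson_bot (RingHom.ker r) (by simp [RingHom.mem_ker, h1])
  have := Ideal.mem_jacobson_bot.mp h2 1
  simpa using this

theorem trace_eq_of_map_eq (r : O →+* K) [IsAdicComplete (RingHom.ker r) O] {E F : Matrix n n O}
    (hE : IsIdempotentElem E)
    (hF : IsIdempotentElem F) (h : E.map r = F.map r) : E.trace = F.trace := by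
  have hu : IsUnit (E * F + (1 - E) * (1 - F)) := by
    refine isUnit_of_map_eq_one r _ ?_
    have hF' : F.map r * F.map r = F.map r := by rw [← Matrix.map_mul, hF.eq]
    have h1 : (1 : Matrix n n O).map r = 1 := by simp
    rw [Matrix.map_add _ (by simp), Matrix.map_mul, Matrix.map_mul, Matrix.map_sub _ (by simp),
      Matrix.map_sub _ (by simp), h, h1]
    noncomm_ring
    simp only [hF']
    abel
  obtain ⟨u, hu⟩ := hu
  have h1 : E * (u : Matrix n n O) = u * F := by
    rw [hu]
    have e1 : E * (E * F + (1 - E) * (1 - F)) = E * F := by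
      have : E * (E * F + (1 - E) * (1 - F)) = (E * E) * F + (E - E * E) * (1 - F) := by
        noncomm_ring
      rw [this, hE.eq, sub_self, zero_mul, add_zero]
    have e2 : (E * F + (1 - E) * (1 - F)) * F = E * F := by
      have : (E * F + (1 - E) * (1 - F)) * F = E * (F * F) + (1 - E) * (F - F * F) := by
        noncomm_ring
      rw [this, hF.eq, sub_self, mul_zero, add_zero]
    rw [e1, e2]
  have h2 : E = u * F * (↑u⁻¹ : Matrix n n O) := by rw [← h1, mul_assoc, Units.mul_inv, mul_one]
  rw [h2, trace_mul_comm, ← mul_assoc, Units.inv_mul, one_mul]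

theorem rank_map_le_finrank (r : O →+* K) (hr : Function.Surjective r)
    [IsAdicComplete (RingHom.ker r) O] {L : Type*} [Field L] (j : O →+* L) {E : Matrix n n O}
    (hE : IsIdempotentElem E) (W : Submodule K (n → K)) (hW : ∀ x, E.map r x ∈ W) :
    (E.map j).rank ≤ Module.finrank K W := by
  let b := Module.finBasis K W
  let A : Matrix n (Fin (Module.finrank K W)) O :=
    of fun x i => Function.surjInv hr (b.repr ⟨_, hW x⟩ i)
  let B : Matrix (Fin (Module.finrank K W)) n O :=
    of fun i x => Function.surjInv hr ((b i : n → K) x)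
  have hAB : (A * B).map r = E.map r := by
    ext x y
    have := congrFun (congrArg Subtype.val (b.sum_repr ⟨_, hW x⟩)) y
    simp only [Submodule.coe_sum, Submodule.coe_smul, Finset.sum_apply, Pi.smul_apply,
      smul_eq_mul] at this
    rw [← this]
    simp [mul_apply, A, B, Function.surjInv_eq hr]
  have hE' : E.map r * E.map r = E.map r := by rw [← Matrix.map_mul, hE.eq]
  obtain ⟨w, hw⟩ := isUnit_of_map_eq_one r (E * (A * B) * E + (1 - E)) (by
    rw [Matrix.map_add _ (by simp), Matrix.map_sub _ (by simp), Matrix.map_mul, Matrix.map_mul,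
      hAB, hE', hE']
    simp)
  have h1 : E * (w : Matrix n n O) = E * A * (B * E) := by
    rw [hw]
    have : E * (E * (A * B) * E + (1 - E)) = (E * E) * (A * B) * E + (E - E * E) := by
      noncomm_ring
    rw [this, hE.eq, sub_self, add_zero]
    simp only [Matrix.mul_assoc]
  have h2 : E = E * A * (B * E * (↑w⁻¹ : Matrix n n O)) := by
    rw [← Matrix.mul_assoc, ← h1, Matrix.mul_assoc, Units.mul_inv, Matrix.mul_one]
  rw [h2, Matrix.map_mul]
  refine (rank_mul_le_left _ _).trans ((rank_le_card_width _).trans ?_)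
  simp

end Lifting

section TraceIdentity

variable {O K G : Type*} [CommRing O] [Field K] [Group G] [Fintype G]

theorem sum_mul_trace_eq_trace_one {κ : Type*} [Fintype κ] [DecidableEq κ] (r : O →+* K)
    [IsAdicComplete (RingHom.ker r) O] (Y : G → Matrix κ κ O) (hY : ∀ g h, Y g * Y h = Y (g * h))
    (b : G → O) (hb : ∀ w, ∑ z, b z * b (z⁻¹ * w) = b w)
    (hr : ∀ a c, ∑ g, r (b g) * r (Y g a c) = r (Y 1 a c)) :
    ∑ g, b g * (Y g).trace = (Y 1).trace := by
  have h1 : IsIdempotentElem (∑ g, b g • Y g) := by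
    rw [IsIdempotentElem, Finset.sum_mul]
    calc ∑ g, b g • Y g * ∑ h, b h • Y h = ∑ g, ∑ w, (b g * b (g⁻¹ * w)) • Y w := by
          refine Finset.sum_congr rfl fun g _ => ?_
          rw [Finset.mul_sum]
          refine Fintype.sum_equiv (Equiv.mulLeft g) _ _ fun h => ?_
          simp [hY, smul_smul, mul_comm]
      _ = ∑ g, b g • Y g := by
          rw [Finset.sum_comm]
          simp [← Finset.sum_smul, hb]
  have h2 : IsIdempotentElem (Y 1) := by rw [IsIdempotentElem, hY, mul_one]
  have h3 := trace_eq_of_map_eq r h1 h2 (by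
    ext a c
    simp [Matrix.sum_apply, hr])
  rw [← h3, trace_sum]
  simp [trace_smul]

theorem sum_mul_one_add_pow_eq [DecidableEq G] (r : O →+* K) [IsAdicComplete (RingHom.ker r) O]
    {X : Submodule K (G → K)} (hX : IsRegularSpace X) (s k : ℕ) {E B : Matrix G G O}
    (hE : IsIdempotentElem E) (hEG : ∀ g x y, E (g * x) (g * y) = E x y)
    (hB : IsIdempotentElem B) (hBG : ∀ g x y, B (g * x) (g * y) = B x y)
    (hEX : ∀ x, E.map r x ∈ X ^ s) (hBX : ∀ c ∈ X ^ (s * k), B.map r *ᵥ c = c) :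
    ∑ g, B 1 g * (1 + ∑ x, E x (g * x)) ^ k = (1 + ∑ x, E x x) ^ k := by
  let τ : G → Matrix (Unit ⊕ G) (Unit ⊕ G) O := fun g =>
    fromBlocks 1 0 0 (of fun x y => E x (g * y))
  have hτ : ∀ g h, τ g * τ h = τ (g * h) := by
    intro g h
    simp only [τ, fromBlocks_multiply]
    simp only [mul_one, Matrix.mul_zero, Matrix.zero_mul, add_zero, zero_add]
    congr 1
    ext x y
    rw [mul_apply, of_apply]
    conv_rhs => rw [← hE.eq, mul_apply]
    refine Fintype.sum_equiv (Equiv.mulLeft g) _ _ fun z => ?_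
    simp [mul_assoc, hEG]
  have hτX : ∀ a c, (fun g => r (τ g a c)) ∈ X ^ s := by
    have h1 : (fun _ => 1 : G → K) ∈ X ^ s :=
      hX.pow_mono (Nat.zero_le s) (Submodule.one_le.mp (pow_zero X).ge)
    have h0 : (fun _ => 0 : G → K) ∈ X ^ s := Submodule.zero_mem _
    rintro (a | a) (c | c)
    · simpa [τ] using h1
    · simpa [τ] using h0
    · simpa [τ] using h0
    · simpa [τ] using hX.pow_right c (hEX a)
  have hτt : ∀ g, (τ g).trace = 1 + ∑ x, E x (g * x) := by
    intro g
    simp [τ, trace]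
  let Y : G → Matrix (Fin k → Unit ⊕ G) (Fin k → Unit ⊕ G) O := fun g =>
    of fun a c => ∏ i, τ g (a i) (c i)
  have hYt : ∀ g, (Y g).trace = (1 + ∑ x, E x (g * x)) ^ k := by
    intro g
    rw [← hτt, trace, trace]
    simp only [diag_apply, Y, of_apply]
    rw [← Fintype.piFinset_univ, ← Finset.prod_univ_sum (fun _ : Fin k => Finset.univ)
      fun _ x => τ g x x]
    simp
  have := sum_mul_trace_eq_trace_one r Y (fun g h => ?_) (fun g => B 1 g) (fun w => ?_)
    (fun a c => ?_)
  · simpa [hYt] using this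
  · ext a c
    simp only [Y, mul_apply, of_apply, ← hτ, ← Finset.prod_mul_distrib]
    rw [Finset.prod_univ_sum, Fintype.piFinset_univ]
  · conv_rhs => rw [← hB.eq, mul_apply]
    refine Finset.sum_congr rfl fun z _ => ?_
    have := hBG z 1 (z⁻¹ * w)
    rw [mul_one, mul_inv_cancel_left] at this
    rw [this]
  · have h1 : (fun g => r (Y g a c)) ∈ X ^ (s * k) := by
      have h2 := prod_mem_pow Finset.univ (fun i g => r (τ g (a i) (c i)))
        (fun i _ => hτX (a i) (c i))
      have h3 : (fun g => r (Y g a c)) = ∏ i, fun g => r (τ g (a i) (c i)) := by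
        ext g; simp [Y]
      rw [h3]
      simpa using h2
    simpa [mulVec, dotProduct] using congrFun (hBX _ h1) 1

end TraceIdentity

theorem exists_orthonormal_columns {n : Type*} [Fintype n] [DecidableEq n] {B : Matrix n n ℂ}
    (hB : IsIdempotentElem B) :
    ∃ d ≤ B.rank, ∃ U : Matrix n (Fin d) ℂ, Uᴴ * U = 1 ∧ U * (Uᴴ * B) = B ∧ B * U = U := by
  set R := LinearMap.range (toEuclideanLin B) with hR
  let b := stdOrthonormalBasis ℂ R
  let U : Matrix n (Fin (Module.finrank ℂ R)) ℂ := of fun x i => (b i : EuclideanSpace ℂ n) x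
  have h1 : Uᴴ * U = 1 := by
    ext i j
    have := orthonormal_iff_ite.mp b.orthonormal i j
    rw [Submodule.coe_inner, EuclideanSpace.inner_eq_star_dotProduct] at this
    rw [one_apply, ← this, mul_apply, dotProduct]
    exact Finset.sum_congr rfl fun x _ => by simp [U, mul_comm]
  have h2 : B * U = U := by
    ext x i
    obtain ⟨v, hv⟩ := (b i).2
    have h3 : toEuclideanLin B (b i : EuclideanSpace ℂ n) = b i := by
      rw [← hv]
      change WithLp.toLp 2 (B *ᵥ (B *ᵥ v.ofLp)) = WithLp.toLp 2 (B *ᵥ v.ofLp)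
      rw [mulVec_mulVec, hB.eq]
    have := congrArg (fun w : EuclideanSpace ℂ n => w x) h3
    simpa [toEuclideanLin, U, mul_apply, mulVec, dotProduct] using this
  have h3 : U * (Uᴴ * B) = B := by
    ext x y
    let v : EuclideanSpace ℂ n := WithLp.toLp 2 fun x => B x y
    have hv : v ∈ R := by
      refine ⟨WithLp.toLp 2 (Pi.single y 1), ?_⟩
      ext x
      simp [toEuclideanLin, v]
    have := congrArg (fun w : R => (w : EuclideanSpace ℂ n) x) (b.sum_repr' ⟨v, hv⟩)
    simp only [Submodule.coe_inner, EuclideanSpace.inner_eq_star_dotProduct] at this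
    simp [dotProduct, v] at this
    rw [← this, mul_apply]
    refine Finset.sum_congr rfl fun i _ => ?_
    simp [U, mul_apply, mul_comm]
  refine ⟨_, ?_, U, h1, h3, h2⟩
  have h4 : (1 : Matrix (Fin (Module.finrank ℂ R)) (Fin (Module.finrank ℂ R)) ℂ).rank ≤ B.rank := by
    rw [← h1]
    refine (rank_mul_le_right _ _).trans ?_
    conv_lhs => rw [← h2]
    exact rank_mul_le_left _ _
  simpa using h4

/-- The range of a left-invariant idempotent matrix carries a unitary representation. -/
theorem exists_unitary_representation {G : Type*} [Group G] [Fintype G] [DecidableEq G]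
    {B : Matrix G G ℂ} (hB : IsIdempotentElem B) (hG : ∀ g x y, B (g * x) (g * y) = B x y) :
    ∃ d ≤ B.rank, ∃ u : G →* unitaryGroup (Fin d) ℂ,
      (∀ g, (u g : Matrix (Fin d) (Fin d) ℂ).trace = ∑ x, B x (g * x)) ∧
      ∀ g, u g = 1 → ∀ x y, B (g * x) y = B x y := by
  obtain ⟨d, hd, U, h1, h2, h3⟩ := exists_orthonormal_columns hB
  let P : G → Matrix G G ℂ := fun g => (1 : Matrix G G ℂ).submatrix (g⁻¹ * ·) id
  have hP : ∀ g (M : Matrix G G ℂ), P g * M = M.submatrix (g⁻¹ * ·) id := by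
    intro g M
    ext x y
    simp [P, mul_apply, one_apply]
  have hPP : ∀ g h, P g * P h = P (g * h) := by
    intro g h
    rw [hP]
    ext x y
    exact congrArg (fun z => (1 : Matrix G G ℂ) z y) (by simp [mul_assoc])
  have hP1 : P 1 = 1 := by
    ext x y
    simp [P, one_apply]
  have hPs : ∀ g, (P g)ᴴ = P g⁻¹ := by
    intro g
    ext x y
    simp only [P, conjTranspose_apply, submatrix_apply, one_apply, id, inv_inv]
    by_cases h : g⁻¹ * y = x
    · simp [← h]
    · have h' : ¬ g * x = y := fun h' => h (by simp [← h'])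
      simp [h, h']
  have hPB : ∀ g, P g * B = B * P g := by
    intro g
    rw [hP]
    ext x y
    rw [submatrix_apply, mul_apply, Finset.sum_eq_single (g * y)]
    · rw [← hG g]
      simp [P, one_apply]
    · intro z _ hz
      have : g⁻¹ * z ≠ y := fun h => hz (by simp [← h])
      simp [P, one_apply, this]
    · simp
  have hUP : ∀ g, U * (Uᴴ * (P g * U)) = P g * U := by
    intro g
    have h4 : P g * U = B * (P g * U) := by
      rw [← Matrix.mul_assoc, ← hPB, Matrix.mul_assoc, h3]
    rw [h4, ← Matrix.mul_assoc Uᴴ, ← Matrix.mul_assoc U, h2]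
  let v : G → Matrix (Fin d) (Fin d) ℂ := fun g => Uᴴ * (P g * U)
  have hv1 : v 1 = 1 := by simp [v, hP1, h1]
  have hvm : ∀ g h, v g * v h = v (g * h) := by
    intro g h
    simp only [v]
    rw [Matrix.mul_assoc, Matrix.mul_assoc, hUP, ← Matrix.mul_assoc (P g), hPP]
  have hvs : ∀ g, star (v g) = v g⁻¹ := by
    intro g
    simp [v, star_eq_conjTranspose, conjTranspose_mul, hPs, Matrix.mul_assoc]
  refine ⟨d, hd, ⟨⟨fun g => ⟨v g, ?_⟩, Subtype.ext hv1⟩, fun g h => Subtype.ext (hvm g h).symm⟩,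
    fun g => ?_, fun g hg x y => ?_⟩
  · rw [mem_unitaryGroup_iff, hvs, hvm, mul_inv_cancel, hv1]
  · change (v g).trace = _
    have h5 : (P g * B).trace = (v g).trace := by
      conv_lhs => rw [← h2, ← Matrix.mul_assoc, trace_mul_comm, Matrix.mul_assoc,
        ← Matrix.mul_assoc B,
        ← hPB, Matrix.mul_assoc, h3]
    rw [← h5, hP, trace]
    refine Fintype.sum_equiv (Equiv.mulLeft g⁻¹) _ _ fun x => ?_
    simp
  · have hg1 : v g = 1 := congrArg Subtype.val hg
    have h6 : P g * B = B := by
      conv_lhs => rw [← h2, ← Matrix.mul_assoc, ← hUP g]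
      change U * v g * (Uᴴ * B) = B
      rw [hg1, Matrix.mul_one, h2]
    have := congrFun (congrFun h6 (g * x)) y
    rw [hP] at this
    simpa using this.symm

section SmallElements

open scoped commutatorElement

variable {G A : Type*} [Group G] [NormedRing A] (ρ : G →* A)

theorem norm_map_sub_one_mul_right (hr : ∀ g a, ‖a * ρ g‖ = ‖a‖) (a b : G) :
    ‖ρ (a * b⁻¹) - 1‖ = ‖ρ a - ρ b‖ := by
  rw [← hr b, sub_mul, one_mul, ← map_mul, inv_mul_cancel_right]

theorem norm_map_commutator_sub_one_le (hr : ∀ g a, ‖a * ρ g‖ = ‖a‖) (g h : G) :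
    ‖ρ ⁅g, h⁆ - 1‖ ≤ 2 * ‖ρ g - 1‖ * ‖ρ h - 1‖ := by
  have h1 : ⁅g, h⁆ = (g * h) * (h * g)⁻¹ := by
    rw [commutatorElement_def]; group
  have h2 : ρ (g * h) - ρ (h * g) = (ρ g - 1) * (ρ h - 1) - (ρ h - 1) * (ρ g - 1) := by
    rw [map_mul, map_mul]; noncomm_ring
  rw [h1, norm_map_sub_one_mul_right ρ hr, h2]
  refine (norm_sub_le _ _).trans ?_
  have h3 := norm_mul_le (ρ g - 1) (ρ h - 1)
  have h4 := norm_mul_le (ρ h - 1) (ρ g - 1)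
  linarith

variable [Finite G] [NormedAlgebra ℝ A]

theorem eq_one_of_forall_norm_pow_sub_one_le (hρ : Function.Injective ρ) (c : G)
    {ε : ℝ} (hε : ε < 1)
    (hc : ∀ j : ℕ, ‖ρ (c ^ j) - 1‖ ≤ ε) : c = 1 := by
  set N := orderOf c with hN
  have hN0 : (0 : ℝ) < N := by exact_mod_cast orderOf_pos c
  set E : A := (N : ℝ)⁻¹ • ∑ j ∈ Finset.range N, ρ (c ^ j) with hE
  have h1 : ρ c * E = E := by
    rw [hE, mul_smul_comm, Finset.mul_sum]
    congr 1
    have e1 := Finset.sum_range_succ (fun j => ρ (c ^ j)) N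
    have e2 := Finset.sum_range_succ' (fun j => ρ (c ^ j)) N
    rw [pow_orderOf_eq_one] at e1
    rw [pow_zero] at e2
    have e3 := add_right_cancel (e2.symm.trans e1)
    rw [← e3]
    exact Finset.sum_congr rfl fun j _ => by rw [← map_mul, pow_succ']
  have h2 : ‖E - 1‖ ≤ ε := by
    have : E - 1 = (N : ℝ)⁻¹ • ∑ j ∈ Finset.range N, (ρ (c ^ j) - 1) := by
      rw [Finset.sum_sub_distrib, smul_sub, ← hE]
      congr 1
      rw [Finset.sum_const, Finset.card_range, ← Nat.cast_smul_eq_nsmul ℝ, smul_smul,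
        inv_mul_cancel₀ hN0.ne', one_smul]
    rw [this, norm_smul, norm_inv, Real.norm_of_nonneg hN0.le, inv_mul_le_iff₀ hN0]
    refine (norm_sum_le _ _).trans ((Finset.sum_le_card_nsmul _ _ ε fun j _ => hc j).trans ?_)
    simp
  have h3 : ‖ρ c - 1‖ ≤ ‖ρ c - 1‖ * ε := by
    have : ρ c - 1 = - ((ρ c - 1) * (E - 1)) := by
      rw [mul_sub, sub_mul, h1]; simp
    conv_lhs => rw [this, norm_neg]
    exact (norm_mul_le _ _).trans (mul_le_mul_of_nonneg_left h2 (norm_nonneg _))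
  have h4 : ‖ρ c - 1‖ = 0 := by nlinarith [norm_nonneg (ρ c - 1)]
  refine hρ ?_
  rw [map_one]
  exact sub_eq_zero.mp (norm_eq_zero.mp h4)

theorem commutator_eq_one_of_commute
    (hl : ∀ g a, ‖ρ g * a‖ = ‖a‖) (hr : ∀ g a, ‖a * ρ g‖ = ‖a‖)
    (hρ : Function.Injective ρ) (g h : G) (hc : Commute g ⁅g, h⁆) (hh : ‖ρ h - 1‖ < 1 / 2) :
    ⁅g, h⁆ = 1 := by
  refine eq_one_of_forall_norm_pow_sub_one_le ρ hρ _ (ε := 2 * ‖ρ h - 1‖) (by linarith)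
    fun j => ?_
  have h1 : h * g⁻¹ * h⁻¹ = g⁻¹ * ⁅g, h⁆ := by
    rw [commutatorElement_def]; group
  have h2 : ⁅g, h⁆ ^ j = (g ^ j * h * (g ^ j)⁻¹) * h⁻¹ := by
    have h3 : h * (g ^ j)⁻¹ * h⁻¹ = (g ^ j)⁻¹ * ⁅g, h⁆ ^ j := by
      rw [← inv_pow, ← (hc.inv_left).mul_pow, ← h1, conj_pow]
    calc ⁅g, h⁆ ^ j = g ^ j * ((g ^ j)⁻¹ * ⁅g, h⁆ ^ j) := by group
      _ = _ := by rw [← h3]; group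
  rw [h2, norm_map_sub_one_mul_right ρ hr]
  have h4 : ‖ρ (g ^ j * h * (g ^ j)⁻¹) - 1‖ = ‖ρ h - 1‖ := by
    rw [norm_map_sub_one_mul_right ρ hr, map_mul, ← mul_sub_one, hl]
  calc ‖ρ (g ^ j * h * (g ^ j)⁻¹) - ρ h‖
      = ‖(ρ (g ^ j * h * (g ^ j)⁻¹) - 1) - (ρ h - 1)‖ := by congr 1; abel
    _ ≤ _ := by
      refine (norm_sub_le _ _).trans ?_
      rw [h4]; linarith

theorem commute_of_norm_sub_one_lt
    (hl : ∀ g a, ‖ρ g * a‖ = ‖a‖) (hr : ∀ g a, ‖a * ρ g‖ = ‖a‖)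
    (hρ : Function.Injective ρ) (g h : G) (hg : ‖ρ g - 1‖ < 1 / 2) (hh : ‖ρ h - 1‖ < 1 / 2) :
    Commute g h := by
  by_contra hne
  obtain ⟨k, ⟨hk, hkg⟩, hmin⟩ := Set.exists_min_image {k : G | ‖ρ k - 1‖ < 1 / 2 ∧ ¬ Commute g k}
    (fun k => ‖ρ k - 1‖) (Set.toFinite _) ⟨h, hh, hne⟩
  have hk0 : 0 < ‖ρ k - 1‖ := by
    rw [norm_pos_iff, sub_ne_zero, ← map_one ρ]
    intro h0
    exact hkg (hρ h0 ▸ Commute.one_right g)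
  have h1 := norm_map_commutator_sub_one_le ρ hr g k
  have h2 : ‖ρ ⁅g, k⁆ - 1‖ < ‖ρ k - 1‖ := by nlinarith
  by_cases hc : Commute g ⁅g, k⁆
  · exact hkg (commutatorElement_eq_one_iff_commute.mp
      (commutator_eq_one_of_commute ρ hl hr hρ g k hc hk))
  · exact absurd (hmin _ ⟨h2.trans hk, hc⟩) (not_le.mpr h2)

end SmallElements

section Frobenius

open scoped Matrix.Norms.Frobenius

theorem frobenius_norm_sq {d : ℕ} (M : Matrix (Fin d) (Fin d) ℂ) : ‖M‖ ^ 2 = (Mᴴ * M).trace.re := by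
  rw [frobenius_norm_def, ← Real.rpow_natCast, ← Real.rpow_mul (by positivity)]
  norm_num
  rw [trace, Complex.re_sum, Finset.sum_comm]
  refine Finset.sum_congr rfl fun j _ => ?_
  rw [diag_apply, mul_apply, Complex.re_sum]
  refine Finset.sum_congr rfl fun i _ => ?_
  rw [Complex.sq_norm, Complex.normSq_apply]
  simp

theorem commute_of_trace_lt {G : Type*} [Group G] [Finite G] {d : ℕ}
    (u : G →* unitaryGroup (Fin d) ℂ) (hu : Function.Injective u) (g h : G)
    (hg : 2 * d - 2 * (u g : Matrix (Fin d) (Fin d) ℂ).trace.re < 1 / 4)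
    (hh : 2 * d - 2 * (u h : Matrix (Fin d) (Fin d) ℂ).trace.re < 1 / 4) : Commute g h := by
  let ρ : G →* Matrix (Fin d) (Fin d) ℂ := (unitaryGroup (Fin d) ℂ).subtype.comp u
  have hs : ∀ g, (ρ g)ᴴ * ρ g = 1 := fun g => mem_unitaryGroup_iff'.mp (u g).2
  have hs' : ∀ g, ρ g * (ρ g)ᴴ = 1 := fun g => mem_unitaryGroup_iff.mp (u g).2
  have hn : ∀ M N : Matrix (Fin d) (Fin d) ℂ, (Mᴴ * M).trace = (Nᴴ * N).trace → ‖M‖ = ‖N‖ := by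
    intro M N h
    rw [← sq_eq_sq₀ (norm_nonneg _) (norm_nonneg _), frobenius_norm_sq, frobenius_norm_sq, h]
  have h1 : ∀ g, 2 * d - 2 * (ρ g).trace.re < 1 / 4 → ‖ρ g - 1‖ < 1 / 2 := by
    intro g hg
    have h2 : ‖ρ g - 1‖ ^ 2 = 2 * d - 2 * (ρ g).trace.re := by
      rw [frobenius_norm_sq]
      have : (ρ g - 1)ᴴ * (ρ g - 1) = 1 + 1 - ρ g - (ρ g)ᴴ := by
        rw [conjTranspose_sub, sub_mul, mul_sub, hs, conjTranspose_one]
        noncomm_ring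
      rw [this]
      simp [trace_conjTranspose]
      ring
    nlinarith [norm_nonneg (ρ g - 1)]
  refine commute_of_norm_sub_one_lt ρ (fun g a => hn _ _ ?_) (fun g a => hn _ _ ?_)
    (Subtype.val_injective.comp hu) g h (h1 g hg) (h1 h hh)
  · rw [conjTranspose_mul, Matrix.mul_assoc, ← Matrix.mul_assoc _ (ρ g), hs, Matrix.one_mul]
  · rw [trace_mul_comm, conjTranspose_mul, Matrix.mul_assoc, ← Matrix.mul_assoc (ρ g), hs',
      Matrix.one_mul, trace_mul_comm]

end Frobenius

section ComplexEstimate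

variable {G : Type*} [Group G]

theorem norm_trace_unitary_le {d : ℕ} (U : unitaryGroup (Fin d) ℂ) :
    ‖(U : Matrix (Fin d) (Fin d) ℂ).trace‖ ≤ d := by
  refine (norm_sum_le _ _).trans ?_
  refine (Finset.sum_le_card_nsmul _ _ 1 fun i _ => entry_norm_bound_of_unitary U.2 i i).trans ?_
  simp

/-- The elements close to the identity in a faithful unitary representation lie in an abelian
normal subgroup. -/
theorem exists_normal_commutative_of_unitary [Finite G] {d : ℕ} (u : G →* unitaryGroup (Fin d) ℂ)
    (hu : Function.Injective u) :
    ∃ A : Subgroup G, A.Normal ∧ (∀ a b : A, a * b = b * a) ∧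
      ∀ g, 2 * d - 2 * (u g : Matrix (Fin d) (Fin d) ℂ).trace.re < 1 / 4 → g ∈ A := by
  set S : Set G := {g | 2 * d - 2 * (u g : Matrix (Fin d) (Fin d) ℂ).trace.re < 1 / 4}
  have hcomm : ∀ x ∈ S, ∀ y ∈ S, x * y = y * x := fun x hx y hy =>
    commute_of_trace_lt u hu x y hx hy
  refine ⟨Subgroup.closure S, ?_, fun a b => ?_, fun g hg => Subgroup.subset_closure hg⟩
  · have hS : Group.conjugatesOfSet S = S := by
      refine Set.Subset.antisymm (fun x hx => ?_) Group.subset_conjugatesOfSet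
      obtain ⟨a, ha, hax⟩ := Group.mem_conjugatesOfSet_iff.mp hx
      obtain ⟨c, rfl⟩ := isConj_iff.mp hax
      have : (u (c * a * c⁻¹) : Matrix (Fin d) (Fin d) ℂ).trace =
          (u a : Matrix (Fin d) (Fin d) ℂ).trace := by
        rw [map_mul, map_mul, map_inv, Submonoid.coe_mul, Submonoid.coe_mul, trace_mul_comm,
          ← Matrix.mul_assoc, ← Submonoid.coe_mul, inv_mul_cancel, Submonoid.coe_one,
          Matrix.one_mul]
      change (_ : ℝ) < _
      rw [this]
      exact ha
    have : Subgroup.closure S = Subgroup.normalClosure S := by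
      rw [Subgroup.normalClosure, hS]
    rw [this]
    infer_instance
  · have := Subgroup.isMulCommutative_closure hcomm
    exact mul_comm' a b

theorem card_mul_pow_le [Fintype G] [DecidableEq G] {B : Matrix G G ℂ} (hB : IsIdempotentElem B)
    (hBG : ∀ g x y, B (g * x) (g * y) = B x y) (ψ : G → ℂ)
    (hψ : ∀ g h, ψ (h * g * h⁻¹) = ψ g) :
    Fintype.card G * ‖∑ g, B 1 g * ψ g‖ ≤ B.rank * ∑ g, ‖ψ g‖ := by
  obtain ⟨d, hd, u, htr, -⟩ := exists_unitary_representation hB hBG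
  have h1 : (Fintype.card G : ℂ) * ∑ g, B 1 g * ψ g =
      ∑ g, (u g : Matrix (Fin d) (Fin d) ℂ).trace * ψ g := by
    calc (Fintype.card G : ℂ) * ∑ g, B 1 g * ψ g = ∑ _h : G, ∑ g, B 1 g * ψ g := by simp
      _ = ∑ h, ∑ g, B h (g * h) * ψ g := by
          refine Finset.sum_congr rfl fun h _ => ?_
          refine Fintype.sum_equiv (MulAut.conj h).toEquiv _ _ fun g => ?_
          have := hBG h 1 g
          simp only [mul_one] at this
          simp [hψ, this]
      _ = _ := by
          rw [Finset.sum_comm]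
          simp [htr, Finset.sum_mul]
  have h2 : (Fintype.card G : ℝ) * ‖∑ g, B 1 g * ψ g‖ =
      ‖∑ g, (u g : Matrix (Fin d) (Fin d) ℂ).trace * ψ g‖ := by
    rw [← h1, norm_mul]; simp
  rw [h2, Finset.mul_sum]
  refine (norm_sum_le _ _).trans (Finset.sum_le_sum fun g _ => ?_)
  rw [norm_mul]
  refine mul_le_mul_of_nonneg_right ((norm_trace_unitary_le _).trans ?_) (norm_nonneg _)
  exact_mod_cast hd

theorem exists_normal_commutative_index_le [Fintype G] [DecidableEq G] {E B : Matrix G G ℂ}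
    (hE : IsIdempotentElem E) (hEG : ∀ g x y, E (g * x) (g * y) = E x y)
    (hE1 : ∀ g, (∀ x y, E (g * x) y = E x y) → g = 1)
    (hB : IsIdempotentElem B) (hBG : ∀ g x y, B (g * x) (g * y) = B x y) (l : ℕ)
    (hEB : ∑ g, B 1 g * (1 + ∑ x, E x (g * x)) ^ (2 * l) = (1 + ∑ x, E x x) ^ (2 * l))
    {Q R : ℕ} (hQ : E.rank ≤ Q) (hR : B.rank ≤ R)
    (hl : 2 * (R : ℝ) * (1 - 1 / (4 * (Q + 1) ^ 2)) ^ l ≤ 1) :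
    ∃ A : Subgroup G, A.Normal ∧ (∀ a b : A, a * b = b * a) ∧ A.index ≤ 2 * R := by
  classical
  obtain ⟨d, hd, u, htr, hu⟩ := exists_unitary_representation hE hEG
  have hinj : Function.Injective u :=
    (injective_iff_map_eq_one u).mpr fun g hg => hE1 g (hu g hg)
  obtain ⟨A, hAn, hAc, hA⟩ := exists_normal_commutative_of_unitary u hinj
  refine ⟨A, hAn, hAc, ?_⟩
  let Φ : G → ℂ := fun g => (u g : Matrix (Fin d) (Fin d) ℂ).trace
  have hΦ1 : Φ 1 = d := by simp [Φ]
  have hΦ : ∀ g h, Φ (h * g * h⁻¹) = Φ g := by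
    intro g h
    simp only [Φ]
    rw [map_mul, map_mul, map_inv, Submonoid.coe_mul, Submonoid.coe_mul, trace_mul_comm,
      ← Matrix.mul_assoc, ← Submonoid.coe_mul, inv_mul_cancel, Submonoid.coe_one, Matrix.one_mul]
  set C : ℝ := ((d : ℝ) + 1) ^ 2 with hC
  set N : ℝ := (Fintype.card G : ℝ)
  have hC1 : 1 ≤ C := by rw [hC]; nlinarith [(Nat.cast_nonneg d : (0 : ℝ) ≤ d)]
  have h1 : N * C ^ l ≤ R * ∑ g, ‖1 + Φ g‖ ^ (2 * l) := by
    have h2 := card_mul_pow_le hB hBG (fun g => (1 + Φ g) ^ (2 * l)) (fun g h => by simp only [hΦ])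
    have h3 : ∑ g, B 1 g * (1 + Φ g) ^ (2 * l) = (1 + Φ 1) ^ (2 * l) := by
      simp only [Φ, htr, one_mul]; exact hEB
    have h4 : ‖(1 + (d : ℂ)) ^ (2 * l)‖ = C ^ l := by
      rw [norm_pow, pow_mul, hC]
      congr 2
      rw [add_comm]
      exact_mod_cast Complex.norm_natCast (d + 1)
    simp only [h3, hΦ1, h4, norm_pow] at h2
    refine h2.trans (mul_le_mul_of_nonneg_right (by exact_mod_cast hR) (by positivity))
  have h5 : ∀ g, ‖1 + Φ g‖ ^ (2 * l) ≤ (if g ∈ A then C ^ l else 0) + (C - 1 / 4) ^ l := by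
    intro g
    have h6 : ‖Φ g‖ ≤ d := norm_trace_unitary_le _
    have h0 : (0 : ℝ) ≤ (C - 1 / 4) ^ l := pow_nonneg (by linarith) _
    rw [pow_mul]
    split_ifs with hg
    · have : ‖1 + Φ g‖ ≤ d + 1 := by
        refine (norm_add_le _ _).trans ?_
        rw [norm_one]; linarith
      have : (‖1 + Φ g‖ ^ 2) ^ l ≤ C ^ l := by rw [hC]; gcongr
      linarith
    · rw [zero_add]
      refine pow_le_pow_left₀ (by positivity) ?_ _
      have h7 : ¬ 2 * d - 2 * (Φ g).re < 1 / 4 := fun h => hg (hA g h)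
      have h8 : ‖1 + Φ g‖ ^ 2 = 1 + 2 * (Φ g).re + ‖Φ g‖ ^ 2 := by
        rw [Complex.sq_norm, Complex.sq_norm, Complex.normSq_apply, Complex.normSq_apply]
        simp
        ring
      rw [h8, hC]
      nlinarith [norm_nonneg (Φ g)]
  have h9 : ∑ g, ‖1 + Φ g‖ ^ (2 * l) ≤ Nat.card A * C ^ l + N * (C - 1 / 4) ^ l := by
    refine (Finset.sum_le_sum fun g _ => h5 g).trans ?_
    rw [Finset.sum_add_distrib, ← Finset.sum_filter, Finset.sum_const, Finset.sum_const,
      nsmul_eq_mul, nsmul_eq_mul, Finset.card_univ]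
    have : (Finset.univ.filter (· ∈ A)).card = Nat.card A := by
      rw [Nat.card_eq_fintype_card, Fintype.card_subtype]
    rw [this]
  have h10 : 2 * R * (C - 1 / 4) ^ l ≤ C ^ l := by
    have e1 : (C - 1 / 4) = C * (1 - 1 / (4 * C)) := by field_simp
    have e2 : (1 - 1 / (4 * C)) ≤ 1 - 1 / (4 * ((Q : ℝ) + 1) ^ 2) := by
      have : (d : ℝ) ≤ Q := by exact_mod_cast hd.trans hQ
      rw [hC]
      gcongr
    have e3 : 0 ≤ 1 - 1 / (4 * C) := by
      rw [sub_nonneg, div_le_one (by positivity)]; linarith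
    calc 2 * R * (C - 1 / 4) ^ l = C ^ l * (2 * R * (1 - 1 / (4 * C)) ^ l) := by
          rw [e1, mul_pow]; ring
      _ ≤ C ^ l * (2 * R * (1 - 1 / (4 * ((Q : ℝ) + 1) ^ 2)) ^ l) := by gcongr
      _ ≤ C ^ l * 1 := by gcongr
      _ = C ^ l := mul_one _
  have hCl : 0 < C ^ l := by positivity
  have hN0 : 0 ≤ N := Nat.cast_nonneg _
  have hR0 : (0 : ℝ) ≤ R := Nat.cast_nonneg _
  have h11 : N ≤ 2 * R * Nat.card A := by
    have e1 := h1.trans (mul_le_mul_of_nonneg_left h9 hR0)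
    have e2 := mul_le_mul_of_nonneg_left h10 hN0
    have e3 : N * C ^ l ≤ (2 * R * Nat.card A) * C ^ l := by linarith
    exact le_of_mul_le_mul_right e3 hCl
  have h12 : A.index * Nat.card A ≤ 2 * R * Nat.card A := by
    rw [A.index_mul_card, Nat.card_eq_fintype_card]
    have h13 : ((Fintype.card G : ℕ) : ℝ) ≤ ((2 * R * Nat.card A : ℕ) : ℝ) := by
      push_cast
      exact h11
    exact Nat.cast_le.mp h13
  exact Nat.le_of_mul_le_mul_right h12 Nat.card_pos

end ComplexEstimate

/-- An exponent for which the geometric decay beats the polynomial growth of the dimensions. -/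
def decayExponent (N Z : ℕ) : ℕ :=
  2 * (N + 1).factorial * 3 ^ N * Z ^ N * (16 * Z ^ (2 * N)) ^ (N + 1)

theorem two_mul_pow_mul_decay_le_one (N Z : ℕ) (hZ : 1 ≤ Z) :
    2 * ((3 * Z * decayExponent N Z : ℕ) : ℝ) ^ N *
      (1 - 1 / (4 * (((Z ^ N : ℕ) : ℝ) + 1) ^ 2)) ^ decayExponent N Z ≤ 1 := by
  set l := decayExponent N Z with hl
  have hz : (1 : ℝ) ≤ Z := by exact_mod_cast hZ
  have hzN : (1 : ℝ) ≤ (Z : ℝ) ^ N := one_le_pow₀ hz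
  set x : ℝ := 1 / (4 * (((Z ^ N : ℕ) : ℝ) + 1) ^ 2) with hx
  have hx1 : x ≤ 1 := by
    rw [hx, div_le_one (by positivity)]
    push_cast
    nlinarith
  have hxl : 1 / (16 * (Z : ℝ) ^ (2 * N)) ≤ x := by
    rw [hx]
    refine one_div_le_one_div_of_le (by positivity) ?_
    push_cast
    rw [mul_comm 2 N, pow_mul]
    nlinarith
  have hlpos : (0 : ℝ) < l := by
    rw [hl, decayExponent]; positivity
  have h1 : (1 - x) ^ l ≤ Real.exp (-(x * l)) := by
    calc (1 - x) ^ l ≤ Real.exp (-x) ^ l :=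
          pow_le_pow_left₀ (by linarith) (Real.one_sub_le_exp_neg x) _
      _ = _ := by rw [← Real.exp_nat_mul]; ring_nf
  have hx0 : 0 < x := by positivity
  have h2 : (x * l) ^ (N + 1) / (N + 1).factorial ≤ Real.exp (x * l) :=
    Real.pow_div_factorial_le_exp _ (by positivity) _
  have h3 : (l : ℝ) = 2 * (N + 1).factorial * 3 ^ N * Z ^ N * (16 * Z ^ (2 * N)) ^ (N + 1) := by
    rw [hl, decayExponent]; push_cast; ring
  have h4 : 2 * ((3 * Z * l : ℕ) : ℝ) ^ N ≤ Real.exp (x * l) := by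
    refine le_trans ?_ h2
    have h5 : (1 / (16 * (Z : ℝ) ^ (2 * N)) * l) ^ (N + 1) ≤ (x * l) ^ (N + 1) := by gcongr
    rw [le_div_iff₀ (by positivity)]
    refine le_trans (le_of_eq ?_) h5
    rw [mul_pow, div_pow, one_pow, pow_succ (l : ℝ) N]
    rw [show (l : ℝ) ^ N * l = l ^ N * (2 * (N + 1).factorial * 3 ^ N * Z ^ N *
      (16 * Z ^ (2 * N)) ^ (N + 1)) by rw [← h3]]
    push_cast
    field_simp
    ring
  calc _ ≤ Real.exp (x * l) * Real.exp (-(x * l)) := by gcongr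
    _ = 1 := by rw [← Real.exp_add]; simp

theorem exists_index_bound (N : ℕ) : ∃ J e : ℕ, ∀ q : ℕ, 1 ≤ q →
    2 * (3 * (3 * q ^ 2 + 2) * decayExponent N (3 * q ^ 2 + 2)) ^ N ≤ J * q ^ e := by
  refine ⟨2 * (3 * 5 * decayExponent N 5) ^ N,
    (2 + (2 * N + 2 * (2 * N) * (N + 1))) * N, fun q hq => ?_⟩
  have h : 3 * q ^ 2 + 2 ≤ 5 * q ^ 2 := by nlinarith
  calc _ ≤ 2 * (3 * (5 * q ^ 2) * decayExponent N (5 * q ^ 2)) ^ N := by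
        simp only [decayExponent]; gcongr
    _ = _ := by
      simp only [decayExponent]
      rw [pow_mul q _ N, mul_assoc 2 (_ ^ N), ← mul_pow]
      congr 2
      ring

theorem WittVector.exists_injective_ringHom_complex (p : ℕ) [Fact p.Prime] (K : Type) [Field K]
    [CharP K p] [Finite K] : ∃ j : WittVector p K →+* ℂ, Function.Injective j := by
  have : PerfectRing K p := PerfectRing.ofFiniteOfIsReduced p K
  have h0 : CharZero (WittVector p K) := by
    refine (CharP.charP_zero_iff_charZero (WittVector p K)).mp ?_
    obtain ⟨q, hq⟩ := CharP.exists (WittVector p K)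
    have h1 : (q : K) = 0 := by
      rw [← map_natCast (WittVector.constantCoeff (p := p) (R := K)) q, CharP.cast_eq_zero,
        map_zero]
    rcases CharP.char_is_prime_or_zero (WittVector p K) q with h2 | rfl
    · have h3 : p = q := (Nat.prime_dvd_prime_iff_eq Fact.out h2).mp
        ((CharP.cast_eq_zero_iff K p q).mp h1)
      subst h3
      exact absurd (CharP.cast_eq_zero (WittVector p K) p) (WittVector.p_nonzero p K)
    · exact hq
  have e0 : WittVector p K ≃ (ℕ → K) :=
    ⟨WittVector.coeff, fun f => WittVector.mk p f, fun x => by ext; rfl, fun f => rfl⟩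
  let F := FractionRing (WittVector p K)
  have h1 : Cardinal.mk (WittVector p K) = Cardinal.continuum := by
    have := Fintype.ofFinite K
    rw [Cardinal.mk_congr e0, Cardinal.mk_pi]
    simp only [Cardinal.prod_const, Cardinal.lift_id, Cardinal.mk_nat]
    rw [Cardinal.mk_fintype]
    exact Cardinal.nat_power_aleph0 (Fintype.one_lt_card)
  have hinf : Infinite (WittVector p K) := inferInstance
  have h2 : Cardinal.mk F = Cardinal.continuum := by
    rw [← h1]; exact Cardinal.mk_fractionRing _
  have : CharZero F :=
    charZero_of_injective_algebraMap (IsFractionRing.injective (WittVector p K) F)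
  have h3 : Cardinal.mk (AlgebraicClosure F) = Cardinal.continuum := by
    refine le_antisymm ?_ ?_
    · refine (Algebra.IsAlgebraic.cardinalMk_le_max F (AlgebraicClosure F)).trans ?_
      rw [h2]
      simp [Cardinal.aleph0_le_continuum]
    · rw [← h2]
      exact Cardinal.mk_le_of_injective (algebraMap F (AlgebraicClosure F)).injective
  have : CharZero (AlgebraicClosure F) :=
    charZero_of_injective_algebraMap (algebraMap F _).injective
  obtain ⟨e⟩ := IsAlgClosed.ringEquiv_of_equiv_of_charZero (K := AlgebraicClosure F) (L := ℂ)
    (by rw [h3]; exact Cardinal.aleph0_lt_continuum)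
    (Cardinal.eq.mp (by rw [h3, Cardinal.mk_complex]))
  exact ⟨(e : AlgebraicClosure F →+* ℂ).comp ((algebraMap F (AlgebraicClosure F)).comp
    (algebraMap (WittVector p K) F)), e.injective.comp ((algebraMap F _).injective.comp
      (IsFractionRing.injective (WittVector p K) F))⟩

theorem IsRegularSpace.exists_normal_commutative_index_le {p : ℕ} [Fact p.Prime] {K : Type}
    {G : Type*} [Field K] [CharP K p] [Finite K] [Group G] [Finite G] {X : Submodule K (G → K)}
    (hX : IsRegularSpace X) (N : ℕ) (hN : ∀ m, Module.finrank K ↥(X ^ m) ≤ (m + 1) ^ N)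
    (P : Subgroup G) (hP : (P.index : K) ≠ 0) (l : ℕ) {D Q R : ℕ} (hD : D = 3 * Nat.card P ^ 2)
    (hQ : (D + 2) ^ N ≤ Q) (hR : (D + (D + 1) * (2 * l) + 1) ^ N ≤ R)
    (hl : 2 * (R : ℝ) * (1 - 1 / (4 * ((Q : ℝ) + 1) ^ 2)) ^ l ≤ 1) :
    ∃ A : Subgroup G, A.Normal ∧ (∀ a b : A, a * b = b * a) ∧ A.index ≤ 2 * R := by
  classical
  have := Fintype.ofFinite G
  have : PerfectRing K p := PerfectRing.ofFiniteOfIsReduced p K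
  let r : WittVector p K →+* K := WittVector.constantCoeff
  have hr : Function.Surjective r := WittVector.constantCoeff_surjective p
  have hr1 : RingHom.ker r = Ideal.span {(p : WittVector p K)} := WittVector.ker_constantCoeff
  have : IsAdicComplete (RingHom.ker r) (WittVector p K) := by rw [hr1]; infer_instance
  obtain ⟨j, hj⟩ := WittVector.exists_injective_ringHom_complex p K
  have lift : ∀ m, ∃ B : Matrix G G (WittVector p K), IsIdempotentElem B ∧
      (∀ g x y, B (g * x) (g * y) = B x y) ∧ (∀ x, B.map r x ∈ X ^ (D + m)) ∧
      ∀ c ∈ X ^ m, B.map r *ᵥ c = c := by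
    intro m
    obtain ⟨B, hB, hBG, hBX, hBc⟩ := hX.exists_invariant_idempotent P hP m
    obtain ⟨A, hA, rfl, hAB⟩ := exists_isIdempotentElem_lift r hr B hB
    refine ⟨A, hA, fun g x y => ?_, hD ▸ hBX, hBc⟩
    exact congrFun (congrFun (hAB (Equiv.mulLeft g) (by ext x y; exact hBG g x y)) x) y
  obtain ⟨E, hE, hEG, hEX, hEc⟩ := lift 1
  obtain ⟨B, hB, hBG, hBX, hBc⟩ := lift ((D + 1) * (2 * l))
  have h1 := sum_mul_one_add_pow_eq r hX (D + 1) (2 * l) hE hEG hB hBG hEX hBc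
  have hmap : ∀ {M : Matrix G G (WittVector p K)}, IsIdempotentElem M →
      IsIdempotentElem (M.map j) :=
    fun {M} hM => by rw [IsIdempotentElem, ← Matrix.map_mul, hM.eq]
  refine _root_.exists_normal_commutative_index_le (E := E.map j) (B := B.map j) (hmap hE)
    (fun g x y => by simp [hEG]) (fun g hg => ?_) (hmap hB) (fun g x y => by simp [hBG]) l ?_
    ((rank_map_le_finrank r hr j hE _ hEX).trans ((hN _).trans hQ))
    ((rank_map_le_finrank r hr j hB _ hBX).trans ((hN _).trans hR)) hl
  · refine hX.separates g fun c hc => ?_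
    have h2 := hEc c (by rwa [pow_one])
    have h3 : ∀ y, E (g * 1) y = E 1 y := fun y => hj (hg 1 y)
    have h4 : (E.map r *ᵥ c) (g * 1) = (E.map r *ᵥ c) 1 := by
      simp only [mulVec, dotProduct, Matrix.map_apply, h3]
    rwa [h2, mul_one] at h4
  · simpa using congrArg j h1

theorem IsRegularSpace.exists_normal_commutative_index_le_pow {p : ℕ} [Fact p.Prime] {K : Type}
    {G : Type*} [Field K] [CharP K p] [Finite K] [Group G] [Finite G] {X : Submodule K (G → K)}
    (hX : IsRegularSpace X) (N : ℕ) (hN : ∀ m, Module.finrank K ↥(X ^ m) ≤ (m + 1) ^ N)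
    (P : Sylow p G) :
    ∃ A : Subgroup G, A.Normal ∧ (∀ a b : A, a * b = b * a) ∧
      A.index ≤ 2 * (3 * (3 * Nat.card P ^ 2 + 2) *
        decayExponent N (3 * Nat.card P ^ 2 + 2)) ^ N := by
  refine hX.exists_normal_commutative_index_le N hN P ?_
    (decayExponent N (3 * Nat.card P ^ 2 + 2)) rfl le_rfl ?_ ?_
  · exact fun h => P.not_dvd_index ((CharP.cast_eq_zero_iff K p _).mp h)
  · have : 1 ≤ decayExponent N (3 * Nat.card P ^ 2 + 2) := by
      rw [decayExponent]; exact Nat.one_le_iff_ne_zero.mpr (by positivity)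
    refine Nat.pow_le_pow_left ?_ _
    nlinarith
  · exact_mod_cast two_mul_pow_mul_decay_le_one N (3 * Nat.card P ^ 2 + 2) (by omega)

theorem isRegularSpace_span {K G n : Type*} [Field K] [Group G] [Fintype n] [DecidableEq n]
    (ρ : G →* Matrix n n K) (hρ : Function.Injective ρ) :
    IsRegularSpace (Submodule.span K (Set.range (Sum.elim (fun _ : Unit => (1 : G → K))
      (Sum.elim (fun (i : n × n) g => ρ g i.1 i.2) fun (i : n × n) g => ρ g⁻¹ i.1 i.2)))) := by
  set v : Unit ⊕ (n × n) ⊕ (n × n) → G → K := Sum.elim (fun _ : Unit => (1 : G → K))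
      (Sum.elim (fun (i : n × n) g => ρ g i.1 i.2) fun (i : n × n) g => ρ g⁻¹ i.1 i.2) with hv
  set X := Submodule.span K (Set.range v)
  have m1 : (1 : G → K) ∈ X := Submodule.subset_span ⟨Sum.inl (), rfl⟩
  have m2 : ∀ i j, (fun g => ρ g i j) ∈ X := fun i j =>
    Submodule.subset_span ⟨Sum.inr (Sum.inl (i, j)), rfl⟩
  have m3 : ∀ i j, (fun g => ρ g⁻¹ i j) ∈ X := fun i j =>
    Submodule.subset_span ⟨Sum.inr (Sum.inr (i, j)), rfl⟩
  have key : ∀ σ : G → G, (∀ i j, (fun g => ρ (σ g) i j) ∈ X) →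
      (∀ i j, (fun g => ρ (σ g)⁻¹ i j) ∈ X) → ∀ c ∈ X, (fun x => c (σ x)) ∈ X := by
    intro σ h2 h3 c hc
    have : X ≤ X.comap (LinearMap.funLeft K K σ) := by
      refine Submodule.span_le.mpr ?_
      rintro _ ⟨_ | i | i, rfl⟩
      · exact m1
      · exact h2 i.1 i.2
      · exact h3 i.1 i.2
    exact this hc
  have mL : ∀ (τ : G → Matrix n n K), (∀ i j, (fun g => τ g i j) ∈ X) →
      ∀ (M : Matrix n n K) i j, (fun g => (M * τ g) i j) ∈ X := by
    intro τ hτ M i j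
    have : (fun g => (M * τ g) i j) = ∑ k, M i k • fun g => τ g k j := by
      ext g; simp [Matrix.mul_apply]
    rw [this]
    exact sum_mem fun k _ => X.smul_mem _ (hτ k j)
  have mR : ∀ (τ : G → Matrix n n K), (∀ i j, (fun g => τ g i j) ∈ X) →
      ∀ (M : Matrix n n K) i j, (fun g => (τ g * M) i j) ∈ X := by
    intro τ hτ M i j
    have : (fun g => (τ g * M) i j) = ∑ k, M k j • fun g => τ g i k := by
      ext g; simp [Matrix.mul_apply, mul_comm]
    rw [this]
    exact sum_mem fun k _ => X.smul_mem _ (hτ i k)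
  refine ⟨Submodule.one_le.mpr m1, fun g => ?_, fun g => ?_, ?_, fun g hg => ?_⟩
  · refine key (fun x => g * x) (fun i j => ?_) fun i j => ?_
    · simpa only [map_mul] using mL _ m2 (ρ g) i j
    · simpa only [_root_.mul_inv_rev, map_mul] using mR _ m3 (ρ g⁻¹) i j
  · refine key (fun x => x * g) (fun i j => ?_) fun i j => ?_
    · simpa only [map_mul] using mR _ m2 (ρ g) i j
    · simpa only [_root_.mul_inv_rev, map_mul] using mL _ m3 (ρ g⁻¹) i j
  · refine key _ m3 fun i j => ?_
    simpa only [inv_inv] using m2 i j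
  · exact hρ (by ext i j; exact hg _ (m2 i j))

theorem exists_finite_field_of_algebraic (p : ℕ) [Fact p.Prime] (L : Type) [Field L]
    [Algebra (ZMod p) L] [Algebra.IsAlgebraic (ZMod p) L] {n G : Type*} [Fintype n]
    [DecidableEq n] [Group G] [Finite G] (ρ : G →* Matrix n n L) (hρ : Function.Injective ρ) :
    ∃ F : IntermediateField (ZMod p) L, Finite F ∧
      ∃ τ : G →* Matrix n n F, Function.Injective τ := by
  let S : Set L := Set.range fun x : G × n × n => ρ x.1 x.2.1 x.2.2
  let F := IntermediateField.adjoin (ZMod p) S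
  have hS : S.Finite := Set.finite_range _
  have : FiniteDimensional (ZMod p) F :=
    IntermediateField.finiteDimensional_adjoin fun x _ => Algebra.IsIntegral.isIntegral x
  have hF : ∀ g i j, ρ g i j ∈ F := fun g i j =>
    IntermediateField.subset_adjoin _ _ ⟨(g, i, j), rfl⟩
  let t : Matrix n n F →+* Matrix n n L := F.val.toRingHom.mapMatrix
  have ht : Function.Injective t := fun a b h => by
    ext i j; exact congrFun (congrFun h i) j
  let τ : G → Matrix n n F := fun g => of fun i j => ⟨ρ g i j, hF g i j⟩
  have hτ : ∀ g, t (τ g) = ρ g := fun g => by ext i j; rfl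
  refine ⟨F, Module.finite_of_finite (ZMod p), ⟨⟨τ, ht ?_⟩, fun g h => ht ?_⟩, fun g h hgh => ?_⟩
  · rw [hτ, map_one, map_one]
  · rw [map_mul, hτ]
    change t (τ (g * h)) = ρ g * t (τ h)
    rw [hτ, hτ, map_mul]
  · refine hρ ?_
    rw [← hτ, ← hτ]
    exact congrArg t hgh
/-- The theorem of Larsen and Pink: for every positive integer `n` the group `GL_n` over
an algebraic closure of the finite field `𝔽_p` is `p`-Jordan, i.e. there exist constants
`J(n)` and `e(n)` such that every finite subgroup `G ⊆ GL_n(𝔽̄_p)` contains a normal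
abelian subgroup `A` with `[G : A] ≤ J(n) * |G_p| ^ e(n)`. -/
theorem isPJordan_gl_algebraicClosure_zmod (p : ℕ) [Fact p.Prime] (n : ℕ) (hn : 0 < n) :
    IsPJordan p (GL (Fin n) (AlgebraicClosure (ZMod p))) := by
  obtain ⟨J, e, h⟩ :=
    exists_index_bound (Fintype.card (Unit ⊕ (Fin n × Fin n) ⊕ (Fin n × Fin n)))
  refine ⟨J, e, fun G hG => ?_⟩
  obtain ⟨F, hF, ρ, hρ⟩ := exists_finite_field_of_algebraic p (AlgebraicClosure (ZMod p))
    ((Units.coeHom (Matrix (Fin n) (Fin n) (AlgebraicClosure (ZMod p)))).comp G.subtype)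
    (Units.val_injective.comp G.subtype_injective)
  have : CharP F p := charP_of_injective_algebraMap (algebraMap (ZMod p) F).injective p
  obtain ⟨P⟩ : Nonempty (Sylow p G) := inferInstance
  obtain ⟨A, hA, hA', hA''⟩ :=
    (isRegularSpace_span ρ hρ).exists_normal_commutative_index_le_pow (p := p) _
      (fun m => finrank_span_range_pow_le _ m) P
  refine ⟨A, hA, hA', fun P' => ?_⟩
  rw [P'.card_eq_multiplicity, ← P.card_eq_multiplicity]
  exact hA''.trans (h _ Nat.card_pos)
end
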